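/- Let c₁ := 3^900·(3/2)^(5/3). For every integer a ≥ 7 for which the ring of integers of the simplest cubic field K_a equals ℤ[ρ], and for every real number x ≥ 1, one has |P(a, x) − (4·Reg_{K_a}/(a² + 3a + 9))·x| ≤ c₁·(log a)^(10/3)·x^(2/3), where Reg_{K_a} is the regulator of K_a. -/

import Mathlib

open NumberField

/-- The largest real root of `X³ - aX² - (a+3)X - 1` (for `a ≥ 7` this set of real roots
is nonempty and bounded above, so `sSup` picks out the largest root). -/
noncomputable def simplestCubicRoot (a : ℤ) : ℝ :=
  sSup {x : ℝ | x ^ 3 - (a : ℝ) * x ^ 2 - ((a : ℝ) + 3) * x - 1 = 0}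

/-- A bounded interval of length `ℓ` contains `n ℓ + O(1)` points of `(1/n)ℤ`. -/
theorem exists_forall_abs_ncard_div_mem_sub_le {T : Set ℝ} (hT : T.OrdConnected) {B : ℝ}
    (hB : ∀ t ∈ T, |t| ≤ B) :
    ∃ l : ℝ, ∀ n : ℕ, 0 < n → |(({k : ℤ | (k : ℝ) / n ∈ T}).ncard : ℝ) - n * l| ≤ 1 := by
  rcases T.eq_empty_or_nonempty with rfl | hne
  · exact ⟨0, fun n _ ↦ by simp⟩
  have hbdd : BddAbove T := ⟨B, fun t ht ↦ (abs_le.mp (hB t ht)).2⟩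
  have hbdd' : BddBelow T := ⟨-B, fun t ht ↦ (abs_le.mp (hB t ht)).1⟩
  have hpq : sInf T ≤ sSup T := csInf_le_csSup hne hbdd' hbdd
  refine ⟨sSup T - sInf T, fun n hn ↦ ?_⟩
  have hn' : (0 : ℝ) < n := Nat.cast_pos.mpr hn
  set p := sInf T
  set q := sSup T
  have hnpq : n * p ≤ n * q := by gcongr
  have hsub : {k : ℤ | (k : ℝ) / n ∈ T} ⊆ (Finset.Icc ⌈n * p⌉ ⌊n * q⌋ : Finset ℤ) := by
    intro k hk
    have h1 : p ≤ (k : ℝ) / n := csInf_le hbdd' hk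
    have h2 : (k : ℝ) / n ≤ q := le_csSup hbdd hk
    rw [le_div_iff₀ hn'] at h1
    rw [div_le_iff₀ hn'] at h2
    simp only [Finset.coe_Icc, Set.mem_Icc]
    exact ⟨Int.ceil_le.mpr (by linarith), Int.le_floor.mpr (by linarith)⟩
  have hsup : ((Finset.Ioo ⌊n * p⌋ ⌈n * q⌉ : Finset ℤ) : Set ℤ) ⊆ {k : ℤ | (k : ℝ) / n ∈ T} := by
    intro k hk
    simp only [Finset.coe_Ioo, Set.mem_Ioo] at hk
    have h1 : p < (k : ℝ) / n := by
      rw [lt_div_iff₀ hn', mul_comm]; exact Int.floor_lt.mp hk.1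
    have h2 : (k : ℝ) / n < q := by
      rw [div_lt_iff₀ hn', mul_comm]; exact Int.lt_ceil.mp hk.2
    obtain ⟨s, hs, hs'⟩ := exists_lt_of_csInf_lt hne h1
    obtain ⟨t, ht, ht'⟩ := exists_lt_of_lt_csSup hne h2
    exact hT.out hs ht ⟨hs'.le, ht'.le⟩
  have hfin : ({k : ℤ | (k : ℝ) / n ∈ T}).Finite := (Finset.finite_toSet _).subset hsub
  have hle := Set.ncard_le_ncard hsub (Finset.finite_toSet _)
  have hge := Set.ncard_le_ncard hsup hfin
  rw [Set.ncard_coe_finset, Int.card_Icc] at hle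
  rw [Set.ncard_coe_finset, Int.card_Ioo] at hge
  have e1 := Int.ceil_lt_add_one (n * p)
  have e2 := Int.le_ceil (n * p)
  have e3 := Int.floor_le (n * q)
  have e4 := Int.lt_floor_add_one (n * q)
  have e5 := Int.floor_le (n * p)
  have e6 := Int.le_ceil (n * q)
  have hnn : 0 ≤ ⌊n * q⌋ + 1 - ⌈n * p⌉ := by
    have : (-1 : ℝ) < ((⌊n * q⌋ + 1 - ⌈n * p⌉ : ℤ) : ℝ) := by push_cast; linarith
    have : (-1 : ℤ) < ⌊n * q⌋ + 1 - ⌈n * p⌉ := by exact_mod_cast this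
    omega
  have hle' : ((({k : ℤ | (k : ℝ) / n ∈ T}).ncard : ℤ) : ℝ) ≤
      ((⌊n * q⌋ + 1 - ⌈n * p⌉ : ℤ) : ℝ) := by
    exact_mod_cast (by omega : (({k : ℤ | (k : ℝ) / n ∈ T}).ncard : ℤ) ≤ ⌊n * q⌋ + 1 - ⌈n * p⌉)
  have hge' : ((⌈n * q⌉ - ⌊n * p⌋ - 1 : ℤ) : ℝ) ≤
      ((({k : ℤ | (k : ℝ) / n ∈ T}).ncard : ℤ) : ℝ) := by
    exact_mod_cast (by omega : ⌈n * q⌉ - ⌊n * p⌋ - 1 ≤ (({k : ℤ | (k : ℝ) / n ∈ T}).ncard : ℤ))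
  push_cast at hle' hge'
  rw [abs_le]
  constructor <;> linarith

theorem abs_ncard_div_mem_sub_mul_ncard_le {T : Set ℝ} (hT : T.OrdConnected) {B : ℝ}
    (hB : ∀ t ∈ T, |t| ≤ B) {n : ℕ} (hn : 0 < n) :
    |(({k : ℤ | (k : ℝ) / n ∈ T}).ncard : ℝ) - n * ({k : ℤ | (k : ℝ) ∈ T}).ncard| ≤ 2 * n := by
  obtain ⟨l, hl⟩ := exists_forall_abs_ncard_div_mem_sub_le hT hB
  have h1 := hl 1 one_pos
  have hn1 := hl n hn
  simp only [Nat.cast_one, div_one, one_mul] at h1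
  have hn' : (1 : ℝ) ≤ n := by exact_mod_cast hn
  rw [abs_le] at *
  constructor <;> nlinarith

theorem ncard_eq_sum_ncard_slice {α β : Type*} {A : Set (α × β)} (hA : A.Finite)
    {J : Finset β} (hJ : ∀ p ∈ A, p.2 ∈ J) :
    A.ncard = ∑ b ∈ J, ({a | (a, b) ∈ A}).ncard := by
  classical
  rw [Set.ncard_eq_toFinset_card A hA,
    Finset.card_eq_sum_card_fiberwise (f := Prod.snd) (t := J) (fun p hp ↦ hJ p (by simpa using hp))]
  refine Finset.sum_congr rfl fun b _ ↦ ?_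
  rw [← Set.ncard_coe_finset]
  have : ((hA.toFinset.filter (fun p ↦ p.2 = b) : Finset (α × β)) : Set (α × β)) =
      (fun a ↦ (a, b)) '' {a | (a, b) ∈ A} := by
    ext ⟨x, y⟩
    simp only [Finset.coe_filter, Set.Finite.mem_toFinset, Set.mem_ofPred_eq, Set.mem_image,
      Prod.mk.injEq]
    constructor
    · rintro ⟨h, rfl⟩; exact ⟨x, h, rfl, rfl⟩
    · rintro ⟨a, h, rfl, rfl⟩; exact ⟨h, rfl⟩
  rw [this, Set.ncard_image_of_injective _ (fun _ _ h ↦ (Prod.mk.inj h).1)]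

/-- The integer points of a subset of `ℝ³`. -/
def latticePoints (S : Set (ℝ × ℝ × ℝ)) : Set (ℤ × ℤ × ℤ) :=
  {v | ((v.1 : ℝ), (v.2.1 : ℝ), (v.2.2 : ℝ)) ∈ S}

theorem mem_Icc_floor_of_abs_le {k : ℤ} {B : ℝ} (h : |(k : ℝ)| ≤ B) :
    k ∈ Finset.Icc (-⌊B⌋) ⌊B⌋ := by
  rw [abs_le] at h
  rw [Finset.mem_Icc, neg_le, Int.le_floor, Int.le_floor]
  push_cast
  exact ⟨by linarith, h.2⟩

theorem card_Icc_floor_le {B : ℝ} (hB : 0 ≤ B) :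
    ((Finset.Icc (-⌊B⌋) ⌊B⌋).card : ℝ) ≤ 2 * B + 1 := by
  have h0 : 0 ≤ ⌊B⌋ := Int.floor_nonneg.mpr hB
  have : (((Finset.Icc (-⌊B⌋) ⌊B⌋).card : ℤ) : ℝ) = 2 * ⌊B⌋ + 1 := by
    rw [Int.card_Icc, Int.toNat_of_nonneg (by omega)]
    push_cast; ring
  have h2 := Int.floor_le B
  rw [Int.cast_natCast] at this
  linarith

theorem finite_latticePoints {S : Set (ℝ × ℝ × ℝ)} {B₀ B₁ B₂ : ℝ}
    (hS : ∀ v ∈ S, |v.1| ≤ B₀ ∧ |v.2.1| ≤ B₁ ∧ |v.2.2| ≤ B₂) : (latticePoints S).Finite := by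
  refine (Finset.finite_toSet (Finset.Icc (-⌊B₀⌋) ⌊B₀⌋ ×ˢ Finset.Icc (-⌊B₁⌋) ⌊B₁⌋ ×ˢ
    Finset.Icc (-⌊B₂⌋) ⌊B₂⌋)).subset fun v hv ↦ ?_
  obtain ⟨h0, h1, h2⟩ := hS _ hv
  simp only [Finset.coe_product, Set.mem_prod, Finset.mem_coe]
  exact ⟨mem_Icc_floor_of_abs_le h0, mem_Icc_floor_of_abs_le h1, mem_Icc_floor_of_abs_le h2⟩

/-- Dilate the first coordinate by `n`, then rotate the coordinates. -/
def dilateRotate (n : ℕ) (S : Set (ℝ × ℝ × ℝ)) : Set (ℝ × ℝ × ℝ) :=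
  {v | (v.2.2 / n, v.1, v.2.1) ∈ S}

theorem convex_dilateRotate (n : ℕ) {S : Set (ℝ × ℝ × ℝ)} (hS : Convex ℝ S) :
    Convex ℝ (dilateRotate n S) := by
  intro v hv w hw s t hs ht hst
  have := hS hv hw hs ht hst
  simp only [dilateRotate, Set.mem_ofPred_eq] at *
  convert this using 1
  ext <;> simp
  ring

theorem dilateRotate_bound {n : ℕ} (hn : 0 < n) {S : Set (ℝ × ℝ × ℝ)} {B₀ B₁ B₂ : ℝ}
    (hS : ∀ v ∈ S, |v.1| ≤ B₀ ∧ |v.2.1| ≤ B₁ ∧ |v.2.2| ≤ B₂) :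
    ∀ v ∈ dilateRotate n S, |v.1| ≤ B₁ ∧ |v.2.1| ≤ B₂ ∧ |v.2.2| ≤ n * B₀ := by
  intro v hv
  obtain ⟨h0, h1, h2⟩ := hS _ hv
  have hn' : (0 : ℝ) < n := Nat.cast_pos.mpr hn
  refine ⟨h1, h2, ?_⟩
  simp only at h0
  rw [abs_div, abs_of_pos hn', div_le_iff₀ hn'] at h0
  linarith

theorem abs_ncard_latticePoints_dilateRotate_sub_le {n : ℕ} (hn : 0 < n) {S : Set (ℝ × ℝ × ℝ)}
    (hconv : Convex ℝ S) {B₀ B₁ B₂ : ℝ} (hB₁ : 0 ≤ B₁) (hB₂ : 0 ≤ B₂)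
    (hS : ∀ v ∈ S, |v.1| ≤ B₀ ∧ |v.2.1| ≤ B₁ ∧ |v.2.2| ≤ B₂) :
    |((latticePoints (dilateRotate n S)).ncard : ℝ) - n * (latticePoints S).ncard| ≤
      2 * n * ((2 * B₁ + 1) * (2 * B₂ + 1)) := by
  set J := Finset.Icc (-⌊B₁⌋) ⌊B₁⌋ ×ˢ Finset.Icc (-⌊B₂⌋) ⌊B₂⌋ with hJ
  have hrot : (latticePoints (dilateRotate n S)).ncard =
      ({v : ℤ × ℤ × ℤ | ((v.1 : ℝ) / n, (v.2.1 : ℝ), (v.2.2 : ℝ)) ∈ S}).ncard := by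
    refine Set.ncard_congr (fun v _ ↦ (v.2.2, v.1, v.2.1)) (fun v hv ↦ hv) ?_ ?_
    · rintro ⟨a, b, c⟩ ⟨a', b', c'⟩ _ _ h
      simp only [Prod.mk.injEq] at h ⊢
      tauto
    · rintro ⟨a, b, c⟩ h
      exact ⟨(b, c, a), h, rfl⟩
  have hfin : ({v : ℤ × ℤ × ℤ | ((v.1 : ℝ) / n, (v.2.1 : ℝ), (v.2.2 : ℝ)) ∈ S}).Finite := by
    have h := finite_latticePoints (dilateRotate_bound hn hS)
    refine (h.image (fun v ↦ (v.2.2, v.1, v.2.1))).subset ?_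
    rintro ⟨a, b, c⟩ h
    exact ⟨(b, c, a), h, rfl⟩
  rw [hrot, ncard_eq_sum_ncard_slice hfin (J := J), ncard_eq_sum_ncard_slice
    (finite_latticePoints hS) (J := J)]
  · push_cast
    rw [Finset.mul_sum, ← Finset.sum_sub_distrib]
    calc _ ≤ ∑ b ∈ J, |((({a : ℤ | (a, b) ∈ {v : ℤ × ℤ × ℤ |
            ((v.1 : ℝ) / n, (v.2.1 : ℝ), (v.2.2 : ℝ)) ∈ S}}).ncard : ℝ) -
          n * ({a : ℤ | (a, b) ∈ latticePoints S}).ncard)| := Finset.abs_sum_le_sum_abs _ _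
      _ ≤ ∑ b ∈ J, (2 * n : ℝ) := by
        refine Finset.sum_le_sum fun b _ ↦ ?_
        refine abs_ncard_div_mem_sub_mul_ncard_le (T := {t : ℝ | (t, (b.1 : ℝ), (b.2 : ℝ)) ∈ S})
          ?_ (B := B₀) (fun t ht ↦ (hS _ ht).1) hn
        refine Convex.ordConnected fun s hs t ht α β hα hβ hαβ ↦ ?_
        have := hconv hs ht hα hβ hαβ
        simp only [Set.mem_ofPred_eq] at *
        convert this using 1
        ext
        · simp
        · simp [← add_mul, hαβ]
        · simp [← add_mul, hαβ]
      _ = 2 * n * ((Finset.Icc (-⌊B₁⌋) ⌊B₁⌋).card * (Finset.Icc (-⌊B₂⌋) ⌊B₂⌋).card) := by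
        rw [Finset.sum_const, hJ, Finset.card_product, nsmul_eq_mul]
        push_cast; ring
      _ ≤ _ := by
        have := card_Icc_floor_le hB₁
        have := card_Icc_floor_le hB₂
        gcongr
  · intro v hv
    obtain ⟨-, h1, h2⟩ := hS _ hv
    exact Finset.mem_product.mpr ⟨mem_Icc_floor_of_abs_le h1, mem_Icc_floor_of_abs_le h2⟩
  · intro v hv
    obtain ⟨-, h1, h2⟩ := hS _ hv
    exact Finset.mem_product.mpr ⟨mem_Icc_floor_of_abs_le h1, mem_Icc_floor_of_abs_le h2⟩

/-- The dilation of a set by `n`. -/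
def dilate (n : ℕ) (S : Set (ℝ × ℝ × ℝ)) : Set (ℝ × ℝ × ℝ) :=
  {v | (v.1 / n, v.2.1 / n, v.2.2 / n) ∈ S}

theorem abs_ncard_latticePoints_dilate_sub_le {n : ℕ} (hn : 0 < n) {S : Set (ℝ × ℝ × ℝ)}
    (hconv : Convex ℝ S) {B : ℝ} (hB : 0 ≤ B)
    (hS : ∀ v ∈ S, |v.1| ≤ B ∧ |v.2.1| ≤ B ∧ |v.2.2| ≤ B) :
    |((latticePoints (dilate n S)).ncard : ℝ) - n ^ 3 * (latticePoints S).ncard| ≤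
      n ^ 3 * (6 * (2 * B + 1) ^ 2) := by
  have hn' : (1 : ℝ) ≤ n := by exact_mod_cast hn
  have hnB : 0 ≤ n * B := by positivity
  have b1 := dilateRotate_bound hn hS
  have b2 := dilateRotate_bound hn b1
  have c1 := convex_dilateRotate n hconv
  have c2 := convex_dilateRotate n c1
  have h1 := abs_ncard_latticePoints_dilateRotate_sub_le hn hconv hB hB hS
  have h2 := abs_ncard_latticePoints_dilateRotate_sub_le hn c1 hB hnB b1
  have h3 := abs_ncard_latticePoints_dilateRotate_sub_le hn c2 hnB hnB b2
  have e : dilateRotate n (dilateRotate n (dilateRotate n S)) = dilate n S := rfl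
  rw [e] at h3
  set a0 := ((latticePoints S).ncard : ℝ)
  set a1 := ((latticePoints (dilateRotate n S)).ncard : ℝ)
  set a2 := ((latticePoints (dilateRotate n (dilateRotate n S))).ncard : ℝ)
  set a3 := ((latticePoints (dilate n S)).ncard : ℝ)
  have hnB' : 2 * (n * B) + 1 ≤ n * (2 * B + 1) := by linarith
  have h2' : |n * (a2 - n * a1)| ≤ n * (2 * n * ((2 * B + 1) * (n * (2 * B + 1)))) := by
    rw [abs_mul, Nat.abs_cast]
    refine mul_le_mul_of_nonneg_left (h2.trans ?_) (by positivity)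
    gcongr
  have h1' : |n ^ 2 * (a1 - n * a0)| ≤ n ^ 2 * (2 * n * ((2 * B + 1) * (2 * B + 1))) := by
    rw [abs_mul, abs_of_nonneg (by positivity : (0 : ℝ) ≤ (n : ℝ) ^ 2)]
    exact mul_le_mul_of_nonneg_left h1 (by positivity)
  have h3' : |a3 - n * a2| ≤ 2 * n * ((n * (2 * B + 1)) * (n * (2 * B + 1))) := by
    refine h3.trans ?_
    gcongr
  have : a3 - n ^ 3 * a0 = (a3 - n * a2) + n * (a2 - n * a1) + n ^ 2 * (a1 - n * a0) := by ring
  rw [this]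
  refine (abs_add_three _ _ _).trans ?_
  calc _ ≤ _ := add_le_add (add_le_add h3' h2') h1'
    _ = _ := by ring

/-- The number of lattice points of the dilate `n S` is `n³` times that of `S`, up to `c n³`. -/
def IsDilationRegular (c : ℝ) (S : Set (ℝ × ℝ × ℝ)) : Prop :=
  (latticePoints S).Finite ∧ ∀ n : ℕ, 0 < n → (latticePoints (dilate n S)).Finite ∧
    |((latticePoints (dilate n S)).ncard : ℝ) - n ^ 3 * (latticePoints S).ncard| ≤ n ^ 3 * c

theorem IsDilationRegular.of_convex {S : Set (ℝ × ℝ × ℝ)} (hconv : Convex ℝ S) {B : ℝ}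
    (hB : 0 ≤ B) (hS : ∀ v ∈ S, |v.1| ≤ B ∧ |v.2.1| ≤ B ∧ |v.2.2| ≤ B) :
    IsDilationRegular (6 * (2 * B + 1) ^ 2) S :=
  ⟨finite_latticePoints hS, fun _ hn ↦
    ⟨finite_latticePoints
      (dilateRotate_bound hn (dilateRotate_bound hn (dilateRotate_bound hn hS))),
    abs_ncard_latticePoints_dilate_sub_le hn hconv hB hS⟩⟩

theorem IsDilationRegular.diff {c d : ℝ} {S T : Set (ℝ × ℝ × ℝ)} (hS : IsDilationRegular c S)
    (hT : IsDilationRegular d T) (h : T ⊆ S) : IsDilationRegular (c + d) (S \ T) := by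
  refine ⟨hS.1.subset fun v hv ↦ hv.1, fun n hn ↦ ⟨(hS.2 n hn).1.subset fun v hv ↦ hv.1, ?_⟩⟩
  have h1 : latticePoints (S \ T) = latticePoints S \ latticePoints T := rfl
  have h2 : latticePoints (dilate n (S \ T)) =
    latticePoints (dilate n S) \ latticePoints (dilate n T) := rfl
  have e1 := Set.ncard_sdiff_add_ncard_of_subset
    (fun v hv ↦ h hv : latticePoints T ⊆ latticePoints S) hS.1
  have e2 := Set.ncard_sdiff_add_ncard_of_subset
    (fun v hv ↦ h hv : latticePoints (dilate n T) ⊆ latticePoints (dilate n S)) (hS.2 n hn).1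
  rw [h1, h2]
  have e1' : ((latticePoints S \ latticePoints T).ncard : ℝ) + (latticePoints T).ncard =
    (latticePoints S).ncard := by exact_mod_cast e1
  have e2' : ((latticePoints (dilate n S) \ latticePoints (dilate n T)).ncard : ℝ) +
    (latticePoints (dilate n T)).ncard = (latticePoints (dilate n S)).ncard := by exact_mod_cast e2
  rw [eq_sub_of_add_eq e1', eq_sub_of_add_eq e2']
  have a1 := (hS.2 n hn).2
  have a2 := (hT.2 n hn).2
  rw [abs_le] at *
  constructor <;> linarith

theorem IsDilationRegular.union {c d : ℝ} {S T : Set (ℝ × ℝ × ℝ)} (hS : IsDilationRegular c S)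
    (hT : IsDilationRegular d T) (h : Disjoint S T) : IsDilationRegular (c + d) (S ∪ T) := by
  refine ⟨hS.1.union hT.1, fun n hn ↦ ⟨(hS.2 n hn).1.union (hT.2 n hn).1, ?_⟩⟩
  have h1 : latticePoints (S ∪ T) = latticePoints S ∪ latticePoints T := rfl
  have h2 : latticePoints (dilate n (S ∪ T)) =
    latticePoints (dilate n S) ∪ latticePoints (dilate n T) := rfl
  have e1 := Set.ncard_union_eq (Set.disjoint_left.mpr fun v hv hv' ↦
    Set.disjoint_left.mp h hv hv' : Disjoint (latticePoints S) (latticePoints T)) hS.1 hT.1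
  have e2 := Set.ncard_union_eq (Set.disjoint_left.mpr fun v hv hv' ↦
    Set.disjoint_left.mp h hv hv' : Disjoint (latticePoints (dilate n S))
      (latticePoints (dilate n T))) (hS.2 n hn).1 (hT.2 n hn).1
  rw [h1, h2, e1, e2]
  push_cast
  have a1 := (hS.2 n hn).2
  have a2 := (hT.2 n hn).2
  rw [abs_le] at *
  constructor <;> linarith

theorem IsDilationRegular.of_split {c : ℝ} {S : Set (ℝ × ℝ × ℝ)} (f : ℝ × ℝ × ℝ → ℝ)
    (hf : ∀ v ∈ S, f v ≠ 0)
    (h : ∀ ε : ℝ, ε = 1 ∨ ε = -1 → IsDilationRegular c (S ∩ {v | 0 < ε * f v})) :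
    IsDilationRegular (2 * c) S := by
  have := (h 1 (Or.inl rfl)).union (h (-1) (Or.inr rfl)) (by
    refine Set.disjoint_left.mpr ?_
    rintro v ⟨-, hv⟩ ⟨-, hv'⟩
    simp only [Set.mem_ofPred_eq] at hv hv'
    linarith)
  rw [← Set.inter_union_distrib_left, ← two_mul] at this
  convert this using 1
  refine (Set.inter_eq_left.mpr fun v hv ↦ ?_).symm
  rcases lt_or_gt_of_ne (hf v hv) with h | h
  · exact Or.inr (by simpa using h)
  · exact Or.inl (by simpa using h)

/-- Superlevel sets of `p log (g / f) + q log (h / f)` on the positive octant are convex. -/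
theorem convex_setOf_le_log_sub_log (f g h : (ℝ × ℝ × ℝ) →ₗ[ℝ] ℝ) {p q : ℝ} (hp : 0 ≤ p)
    (hq : 0 ≤ q) (c : ℝ) :
    Convex ℝ {v | (0 < f v ∧ 0 < g v ∧ 0 < h v) ∧
      c ≤ p * (Real.log (g v) - Real.log (f v)) + q * (Real.log (h v) - Real.log (f v))} := by
  rintro v ⟨⟨fv, gv, hv⟩, cv⟩ w ⟨⟨fw, gw, hw⟩, cw⟩ s t hs ht hst
  have key : ∀ a b a' b' : ℝ, 0 < a → 0 < b → 0 < a' → 0 < b' → 0 < s * a + t * a' := by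
    intro a b a' b' ha _ ha' _
    rcases hs.lt_or_eq with h | h
    · have := mul_pos h ha; have := mul_nonneg ht ha'.le; linarith
    · have : t = 1 := by linarith
      rw [← h, this]; linarith
  have hf : 0 < s * f v + t * f w := key _ _ _ _ fv fv fw fw
  have hg : 0 < s * g v + t * g w := key _ _ _ _ gv gv gw gw
  have hh : 0 < s * h v + t * h w := key _ _ _ _ hv hv hw hw
  set F := s * f v + t * f w with hF
  have h1 : 0 ≤ s * f v / F := by positivity
  have h2 : 0 ≤ t * f w / F := by positivity
  have h3 : s * f v / F + t * f w / F = 1 := by rw [← add_div, div_self hf.ne']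
  have conc : ∀ a a' : ℝ, 0 < a → 0 < a' → 0 < s * a + t * a' →
      s * f v / F * (Real.log a - Real.log (f v)) + t * f w / F * (Real.log a' - Real.log (f w))
        ≤ Real.log (s * a + t * a') - Real.log F := by
    intro a a' ha ha' hpos
    have := strictConcaveOn_log_Ioi.concaveOn.2 (Set.mem_Ioi.mpr (div_pos ha fv))
      (Set.mem_Ioi.mpr (div_pos ha' fw)) h1 h2 h3
    simp only [smul_eq_mul] at this
    rw [Real.log_div ha.ne' fv.ne', Real.log_div ha'.ne' fw.ne'] at this
    refine this.trans (le_of_eq ?_)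
    rw [← Real.log_div hpos.ne' hf.ne']
    congr 1
    field_simp
  have k1 := mul_le_mul_of_nonneg_left (conc _ _ gv gw hg) hp
  have k2 := mul_le_mul_of_nonneg_left (conc _ _ hv hw hh) hq
  have k3 := mul_le_mul_of_nonneg_left cv h1
  have k4 := mul_le_mul_of_nonneg_left cw h2
  simp only [Set.mem_ofPred_eq, map_add, map_smul, smul_eq_mul]
  refine ⟨⟨hf, hg, hh⟩, ?_⟩
  have : c = s * f v / F * c + t * f w / F * c := by rw [← add_mul, h3, one_mul]
  rw [this]
  linarith

/-- Superlevel sets of a product of three positive linear forms are convex. -/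
theorem convex_setOf_lt_log_add_log (f g h : (ℝ × ℝ × ℝ) →ₗ[ℝ] ℝ) (c : ℝ) :
    Convex ℝ {v | (0 < f v ∧ 0 < g v ∧ 0 < h v) ∧
      c < Real.log (f v) + Real.log (g v) + Real.log (h v)} := by
  have hlog : ∀ l : (ℝ × ℝ × ℝ) →ₗ[ℝ] ℝ,
      ConcaveOn ℝ {v | 0 < l v} (fun v ↦ Real.log (l v)) := fun l ↦
    strictConcaveOn_log_Ioi.concaveOn.comp_linearMap l
  have hconv : Convex ℝ {v | 0 < f v ∧ 0 < g v ∧ 0 < h v} :=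
    (hlog f).1.inter ((hlog g).1.inter (hlog h).1)
  have h1 := ((((hlog f).subset (fun v hv ↦ hv.1) hconv).add
    ((hlog g).subset (fun v hv ↦ hv.2.1) hconv)).add
    ((hlog h).subset (fun v hv ↦ hv.2.2) hconv)).convex_gt c
  exact h1

/-- The conjugates of the root `ρ` of the simplest cubic polynomial. -/
noncomputable def conj₁ (ρ : ℝ) : ℝ := -1 / (1 + ρ)

/-- The remaining conjugate of the root `ρ` of the simplest cubic polynomial. -/
noncomputable def conj₂ (ρ : ℝ) : ℝ := -(1 + ρ) / ρ

/-- Evaluation of `v₀ + v₁ X + v₂ X²` at `t`. -/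
def evalAt (t : ℝ) : (ℝ × ℝ × ℝ) →ₗ[ℝ] ℝ where
  toFun v := v.1 + v.2.1 * t + v.2.2 * t ^ 2
  map_add' v w := by simp only [Prod.fst_add, Prod.snd_add]; ring
  map_smul' c v := by simp only [Prod.smul_fst, Prod.smul_snd, smul_eq_mul, RingHom.id_apply]; ring

theorem evalAt_apply (t : ℝ) (v : ℝ × ℝ × ℝ) :
    evalAt t v = v.1 + v.2.1 * t + v.2.2 * t ^ 2 := rfl

/-- Coefficient of the logarithmic vector of `ρ` in the decomposition of a logarithmic vector. -/
noncomputable def coordFst (ρ z₀ z₁ z₂ : ℝ) : ℝ :=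
  (2 * Real.log ρ - Real.log (1 + ρ)) /
      (3 * (Real.log ρ * Real.log (1 + ρ) + (Real.log (1 + ρ) - Real.log ρ) ^ 2)) * (z₀ - z₁) +
    (2 * Real.log (1 + ρ) - Real.log ρ) /
      (3 * (Real.log ρ * Real.log (1 + ρ) + (Real.log (1 + ρ) - Real.log ρ) ^ 2)) * (z₂ - z₁)

/-- Coefficient of the logarithmic vector of `1 + ρ` in the decomposition of a logarithmic
vector. -/
noncomputable def coordSnd (ρ z₀ z₁ z₂ : ℝ) : ℝ :=
  (2 * Real.log (1 + ρ) - Real.log ρ) /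
      (3 * (Real.log ρ * Real.log (1 + ρ) + (Real.log (1 + ρ) - Real.log ρ) ^ 2)) * (z₀ - z₂) +
    (2 * Real.log ρ - Real.log (1 + ρ)) /
      (3 * (Real.log ρ * Real.log (1 + ρ) + (Real.log (1 + ρ) - Real.log ρ) ^ 2)) * (z₁ - z₂)

theorem coordFst_add (ρ x₀ x₁ x₂ y₀ y₁ y₂ : ℝ) :
    coordFst ρ (x₀ + y₀) (x₁ + y₁) (x₂ + y₂) = coordFst ρ x₀ x₁ x₂ + coordFst ρ y₀ y₁ y₂ := by
  unfold coordFst; ring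

theorem coordSnd_add (ρ x₀ x₁ x₂ y₀ y₁ y₂ : ℝ) :
    coordSnd ρ (x₀ + y₀) (x₁ + y₁) (x₂ + y₂) = coordSnd ρ x₀ x₁ x₂ + coordSnd ρ y₀ y₁ y₂ := by
  unfold coordSnd; ring

section

variable {ρ : ℝ} (hρ : 2 ≤ ρ)
include hρ

theorem log_root_pos : 0 < Real.log ρ := Real.log_pos (by linarith)

theorem log_root_lt : Real.log ρ < Real.log (1 + ρ) :=
  Real.log_lt_log (by linarith) (by linarith)

theorem log_one_add_root_le : Real.log (1 + ρ) ≤ 2 * Real.log ρ := by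
  rw [← Real.log_rpow (by linarith)]
  refine Real.log_le_log (by linarith) ?_
  norm_cast
  nlinarith

theorem coord_denom_pos :
    0 < 3 * (Real.log ρ * Real.log (1 + ρ) + (Real.log (1 + ρ) - Real.log ρ) ^ 2) := by
  have h1 := log_root_pos hρ
  have h2 := h1.trans (log_root_lt hρ)
  positivity

omit hρ in
theorem log_conj₁ : Real.log (conj₁ ρ) = -Real.log (1 + ρ) := by
  rw [conj₁, neg_div, Real.log_neg_eq_log, one_div, Real.log_inv]

theorem log_conj₂ : Real.log (conj₂ ρ) = Real.log (1 + ρ) - Real.log ρ := by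
  rw [conj₂, neg_div, Real.log_neg_eq_log, Real.log_div (by linarith) (by linarith)]

theorem log_one_add_conj₁ : Real.log (1 + conj₁ ρ) = Real.log ρ - Real.log (1 + ρ) := by
  have : 1 + conj₁ ρ = ρ / (1 + ρ) := by
    have : 1 + ρ ≠ 0 := by linarith
    rw [conj₁]; field_simp; ring
  rw [this, Real.log_div (by linarith) (by linarith)]

theorem log_one_add_conj₂ : Real.log (1 + conj₂ ρ) = -Real.log ρ := by
  have : 1 + conj₂ ρ = -ρ⁻¹ := by
    have : ρ ≠ 0 := by linarith
    rw [conj₂]; field_simp; ring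
  rw [this, Real.log_neg_eq_log, Real.log_inv]

theorem coordFst_root :
    coordFst ρ (Real.log ρ) (Real.log (conj₁ ρ)) (Real.log (conj₂ ρ)) = 1 := by
  have := (coord_denom_pos hρ).ne'
  rw [log_conj₁, log_conj₂ hρ, coordFst, div_mul_eq_mul_div, div_mul_eq_mul_div, ← add_div,
    div_eq_one_iff_eq this]
  ring

theorem coordSnd_root :
    coordSnd ρ (Real.log ρ) (Real.log (conj₁ ρ)) (Real.log (conj₂ ρ)) = 0 := by
  rw [log_conj₁, log_conj₂ hρ, coordSnd, div_mul_eq_mul_div, div_mul_eq_mul_div, ← add_div,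
    div_eq_zero_iff]
  left; ring

theorem coordFst_one_add_root :
    coordFst ρ (Real.log (1 + ρ)) (Real.log (1 + conj₁ ρ)) (Real.log (1 + conj₂ ρ)) = 0 := by
  rw [log_one_add_conj₁ hρ, log_one_add_conj₂ hρ, coordFst, div_mul_eq_mul_div,
    div_mul_eq_mul_div, ← add_div, div_eq_zero_iff]
  left; ring

theorem coordSnd_one_add_root :
    coordSnd ρ (Real.log (1 + ρ)) (Real.log (1 + conj₁ ρ)) (Real.log (1 + conj₂ ρ)) = 1 := by
  have := (coord_denom_pos hρ).ne'
  rw [log_one_add_conj₁ hρ, log_one_add_conj₂ hρ, coordSnd, div_mul_eq_mul_div,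
    div_mul_eq_mul_div, ← add_div, div_eq_one_iff_eq this]
  ring

theorem log_decomposition₀ (z₀ z₁ z₂ : ℝ) : z₀ = (z₀ + z₁ + z₂) / 3 +
    coordFst ρ z₀ z₁ z₂ * Real.log ρ + coordSnd ρ z₀ z₁ z₂ * Real.log (1 + ρ) := by
  have := (coord_denom_pos hρ).ne'
  unfold coordFst coordSnd
  generalize Real.log ρ = A at *
  generalize Real.log (1 + ρ) = B at *
  have : A * B + (B - A) ^ 2 ≠ 0 := right_ne_zero_of_mul this
  field_simp
  ring

theorem log_decomposition₁ (z₀ z₁ z₂ : ℝ) : z₁ = (z₀ + z₁ + z₂) / 3 -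
    coordFst ρ z₀ z₁ z₂ * Real.log (1 + ρ) -
    coordSnd ρ z₀ z₁ z₂ * (Real.log (1 + ρ) - Real.log ρ) := by
  have := (coord_denom_pos hρ).ne'
  unfold coordFst coordSnd
  generalize Real.log ρ = A at *
  generalize Real.log (1 + ρ) = B at *
  have : A * B + (B - A) ^ 2 ≠ 0 := right_ne_zero_of_mul this
  field_simp
  ring

theorem log_decomposition₂ (z₀ z₁ z₂ : ℝ) : z₂ = (z₀ + z₁ + z₂) / 3 +
    coordFst ρ z₀ z₁ z₂ * (Real.log (1 + ρ) - Real.log ρ) -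
    coordSnd ρ z₀ z₁ z₂ * Real.log ρ := by
  have := (coord_denom_pos hρ).ne'
  unfold coordFst coordSnd
  generalize Real.log ρ = A at *
  generalize Real.log (1 + ρ) = B at *
  have : A * B + (B - A) ^ 2 ≠ 0 := right_ne_zero_of_mul this
  field_simp
  ring

end

/-- The triples of reals of product at most `x` in absolute value whose logarithmic vector lies in
the fundamental parallelogram of the units `ρ` and `1 + ρ`. -/
def fundamentalRegion (ρ x : ℝ) : Set (ℝ × ℝ × ℝ) :=
  {y | (y.1 ≠ 0 ∧ y.2.1 ≠ 0 ∧ y.2.2 ≠ 0) ∧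
    (0 ≤ coordFst ρ (Real.log y.1) (Real.log y.2.1) (Real.log y.2.2) ∧
      coordFst ρ (Real.log y.1) (Real.log y.2.1) (Real.log y.2.2) < 1) ∧
    (0 ≤ coordSnd ρ (Real.log y.1) (Real.log y.2.1) (Real.log y.2.2) ∧
      coordSnd ρ (Real.log y.1) (Real.log y.2.1) (Real.log y.2.2) < 1) ∧
    |y.1 * y.2.1 * y.2.2| ≤ x}

theorem log_sum_eq {a b c : ℝ} (ha : a ≠ 0) (hb : b ≠ 0) (hc : c ≠ 0) :
    Real.log a + Real.log b + Real.log c = Real.log |a * b * c| := by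
  rw [Real.log_abs, Real.log_mul (mul_ne_zero ha hb) hc, Real.log_mul ha hb]

theorem fundamentalRegion_bound {ρ X : ℝ} (hρ : 2 ≤ ρ) (hX : 0 < X) {y : ℝ × ℝ × ℝ}
    (hy : y ∈ fundamentalRegion ρ (X ^ 3)) :
    |y.1| ≤ ρ * (1 + ρ) * X ∧ |y.2.1| ≤ X ∧ |y.2.2| ≤ 2 * X := by
  obtain ⟨⟨h0, h1, h2⟩, ⟨s0, s1⟩, ⟨r0, r1⟩, hN⟩ := hy
  have hm := log_sum_eq h0 h1 h2
  have hm' : Real.log |y.1 * y.2.1 * y.2.2| ≤ 3 * Real.log X := by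
    have := Real.log_le_log (abs_pos.mpr (mul_ne_zero (mul_ne_zero h0 h1) h2)) hN
    rwa [Real.log_pow] at this
  have A := log_root_pos hρ
  have AB := log_root_lt hρ
  have d0 := log_decomposition₀ hρ (Real.log y.1) (Real.log y.2.1) (Real.log y.2.2)
  have d1 := log_decomposition₁ hρ (Real.log y.1) (Real.log y.2.1) (Real.log y.2.2)
  have d2 := log_decomposition₂ hρ (Real.log y.1) (Real.log y.2.1) (Real.log y.2.2)
  set s := coordFst ρ (Real.log y.1) (Real.log y.2.1) (Real.log y.2.2)
  set r := coordSnd ρ (Real.log y.1) (Real.log y.2.1) (Real.log y.2.2)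
  rw [hm] at d0 d1 d2
  have hρ0 : 0 < ρ := by linarith
  have hB : 0 ≤ Real.log (1 + ρ) := by linarith
  have hd : 0 ≤ Real.log (1 + ρ) - Real.log ρ := by linarith
  refine ⟨?_, ?_, ?_⟩
  · rw [← Real.log_le_log_iff (abs_pos.mpr h0) (by positivity), Real.log_abs,
      Real.log_mul (by positivity) (by positivity), Real.log_mul (by positivity) (by positivity)]
    have e1 := mul_le_mul_of_nonneg_right s1.le A.le
    have e2 := mul_le_mul_of_nonneg_right r1.le hB
    linarith
  · rw [← Real.log_le_log_iff (abs_pos.mpr h1) hX, Real.log_abs]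
    have e1 := mul_nonneg s0 hB
    have e2 := mul_nonneg r0 hd
    linarith
  · rw [← Real.log_le_log_iff (abs_pos.mpr h2) (by positivity), Real.log_abs,
      Real.log_mul (by positivity) (by positivity)]
    have e1 := mul_le_mul_of_nonneg_right s1.le hd
    have e2 := mul_nonneg r0 A.le
    have e3 : Real.log (1 + ρ) ≤ Real.log 2 + Real.log ρ := by
      rw [← Real.log_mul (by norm_num) (by positivity)]
      exact Real.log_le_log (by positivity) (by linarith)
    linarith

/-- The three conjugates of `v₀ + v₁ ρ + v₂ ρ²`. -/
noncomputable def conjugates (ρ : ℝ) (v : ℝ × ℝ × ℝ) : ℝ × ℝ × ℝ :=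
  (evalAt ρ v, evalAt (conj₁ ρ) v, evalAt (conj₂ ρ) v)

theorem eq_of_evalAt {r s t : ℝ} (hrs : r ≠ s) (hrt : r ≠ t) (hst : s ≠ t) (v : ℝ × ℝ × ℝ) :
    v.1 = evalAt r v * (s * t) / ((r - s) * (r - t)) +
        evalAt s v * (r * t) / ((s - r) * (s - t)) + evalAt t v * (r * s) / ((t - r) * (t - s)) ∧
      v.2.1 = evalAt r v * (-(s + t)) / ((r - s) * (r - t)) +
        evalAt s v * (-(r + t)) / ((s - r) * (s - t)) +
          evalAt t v * (-(r + s)) / ((t - r) * (t - s)) ∧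
      v.2.2 = evalAt r v * 1 / ((r - s) * (r - t)) +
        evalAt s v * 1 / ((s - r) * (s - t)) + evalAt t v * 1 / ((t - r) * (t - s)) := by
  have h1 := sub_ne_zero.mpr hrs
  have h2 := sub_ne_zero.mpr hrt
  have h3 := sub_ne_zero.mpr hst
  have e1 : s - r = -(r - s) := by ring
  have e2 : t - r = -(r - t) := by ring
  have e3 : t - s = -(s - t) := by ring
  simp only [evalAt_apply, e1, e2, e3]
  refine ⟨?_, ?_, ?_⟩ <;> field_simp <;> ring

theorem abs_mul_div_le {y b Y N D X : ℝ} {d : ℝ} (hy : |y| ≤ Y) (hb : |b| ≤ N) (hd : D ≤ |d|)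
    (hD : 0 < D) (h : Y * N ≤ X * D) (hX : 0 ≤ X) : |y * b / d| ≤ X := by
  rw [abs_div, abs_mul, div_le_iff₀ (hD.trans_le hd)]
  calc |y| * |b| ≤ Y * N := by gcongr; exact (abs_nonneg _).trans hy
    _ ≤ X * D := h
    _ ≤ X * |d| := by gcongr

theorem isDilationRegular_window {X : ℝ} (hX : 0 ≤ X) (pos big : Set (ℝ × ℝ × ℝ))
    (s r : ℝ × ℝ × ℝ → ℝ) (convs : ∀ τ, Convex ℝ {v | v ∈ pos ∧ τ ≤ s v})
    (convr : ∀ τ, Convex ℝ {v | v ∈ pos ∧ τ ≤ r v}) (convbig : Convex ℝ big) :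
    IsDilationRegular (6 * (2 * X + 1) ^ 2 + 6 * (2 * X + 1) ^ 2 +
        (6 * (2 * X + 1) ^ 2 + 6 * (2 * X + 1) ^ 2) +
        (6 * (2 * X + 1) ^ 2 + 6 * (2 * X + 1) ^ 2 +
          (6 * (2 * X + 1) ^ 2 + 6 * (2 * X + 1) ^ 2)))
      {v | (|v.1| ≤ X ∧ |v.2.1| ≤ X ∧ |v.2.2| ≤ X) ∧ v ∈ pos ∧ (0 ≤ s v ∧ s v < 1) ∧
        (0 ≤ r v ∧ r v < 1) ∧ v ∉ big} := by
  obtain ⟨box, hbox⟩ : ∃ box : Set (ℝ × ℝ × ℝ),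
    box = {v | |v.1| ≤ X ∧ |v.2.1| ≤ X ∧ |v.2.2| ≤ X} := ⟨_, rfl⟩
  have convbox : Convex ℝ box := by
    have : box = Set.Icc (-X) X ×ˢ Set.Icc (-X) X ×ˢ Set.Icc (-X) X := by
      ext v; simp only [hbox, abs_le, Set.mem_prod, Set.mem_Icc, Set.mem_ofPred_eq]
    rw [this]
    exact (convex_Icc _ _).prod ((convex_Icc _ _).prod (convex_Icc _ _))
  have hboxmem : ∀ v ∈ box, |v.1| ≤ X ∧ |v.2.1| ≤ X ∧ |v.2.2| ≤ X := fun v hv ↦ by rwa [hbox] at hv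
  obtain ⟨P, hP⟩ : ∃ P : ℝ → ℝ → Set (ℝ × ℝ × ℝ), ∀ τ υ,
    P τ υ = box ∩ ({v | v ∈ pos ∧ τ ≤ s v} ∩ {v | v ∈ pos ∧ υ ≤ r v}) := ⟨_, fun _ _ ↦ rfl⟩
  have hPv : ∀ τ υ v, v ∈ P τ υ ↔ v ∈ box ∧ v ∈ pos ∧ τ ≤ s v ∧ υ ≤ r v := by
    intro τ υ v
    simp only [hP, Set.mem_inter_iff, Set.mem_ofPred_eq]; tauto
  have convP : ∀ τ υ, Convex ℝ (P τ υ) := fun τ υ ↦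
    hP τ υ ▸ convbox.inter ((convs τ).inter (convr υ))
  have regP : ∀ τ υ, IsDilationRegular (6 * (2 * X + 1) ^ 2) (P τ υ) := fun τ υ ↦
    .of_convex (convP τ υ) hX (fun v hv ↦ hboxmem v ((hPv _ _ _).mp hv).1)
  have regQ : ∀ τ υ, IsDilationRegular (6 * (2 * X + 1) ^ 2) (P τ υ ∩ big) := fun τ υ ↦
    .of_convex ((convP τ υ).inter convbig) hX (fun v hv ↦ hboxmem v ((hPv _ _ _).mp hv.1).1)
  have mono : ∀ {τ υ τ' υ'}, τ ≤ τ' → υ ≤ υ' → P τ' υ' ⊆ P τ υ := by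
    intro τ υ τ' υ' h1 h2 v hv
    rw [hPv] at hv ⊢
    exact ⟨hv.1, hv.2.1, h1.trans hv.2.2.1, h2.trans hv.2.2.2⟩
  have regA := ((regP 0 0).diff (regP 1 0) (mono zero_le_one le_rfl)).diff
    ((regP 0 1).diff (regP 1 1) (mono zero_le_one le_rfl)) (by
      rintro v ⟨hv, hv'⟩
      refine ⟨mono le_rfl zero_le_one hv, fun hv'' ↦ hv' ?_⟩
      rw [hPv] at hv hv'' ⊢
      exact ⟨hv.1, hv.2.1, hv''.2.2.1, hv.2.2.2⟩)
  have regB := ((regQ 0 0).diff (regQ 1 0)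
      (Set.inter_subset_inter_left _ (mono zero_le_one le_rfl))).diff
    ((regQ 0 1).diff (regQ 1 1) (Set.inter_subset_inter_left _ (mono zero_le_one le_rfl))) (by
      rintro v ⟨⟨hv, hb⟩, hv'⟩
      refine ⟨⟨mono le_rfl zero_le_one hv, hb⟩, fun hv'' ↦ hv' ⟨?_, hb⟩⟩
      have hv1 := hv''.1
      rw [hPv] at hv hv1 ⊢
      exact ⟨hv.1, hv.2.1, hv1.2.2.1, hv.2.2.2⟩)
  have reg := regA.diff regB (by
    rintro v ⟨⟨h1, h2⟩, h3⟩
    exact ⟨⟨h1.1, fun h ↦ h2 ⟨h, h1.2⟩⟩, fun h ↦ h3 ⟨⟨h.1, h1.2⟩, fun h' ↦ h.2 h'.1⟩⟩)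
  convert reg using 1
  ext v
  have hb : v ∈ box ↔ |v.1| ≤ X ∧ |v.2.1| ≤ X ∧ |v.2.2| ≤ X := by rw [hbox]; rfl
  simp only [Set.mem_inter_iff, Set.mem_sdiff, hPv, Set.mem_ofPred_eq, ← hb, ← not_le]
  tauto

section

variable {ρ : ℝ} (hρ : 2 ≤ ρ)
include hρ

theorem conj₁_bounds : -1 / 3 ≤ conj₁ ρ ∧ conj₁ ρ < 0 := by
  have h : 0 < 1 + ρ := by linarith
  constructor
  · rw [conj₁, le_div_iff₀ h]; linarith
  · rw [conj₁, div_lt_iff₀ h]; linarith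

theorem conj₂_bounds : -3 / 2 ≤ conj₂ ρ ∧ conj₂ ρ < -1 := by
  have h : 0 < ρ := by linarith
  constructor
  · rw [conj₂, le_div_iff₀ h]; linarith
  · rw [conj₂, div_lt_iff₀ h]; linarith

theorem one_le_conj₁_sub_conj₂ : 1 ≤ conj₁ ρ - conj₂ ρ := by
  have h : 0 < 1 + ρ := by linarith
  have h' : 0 < ρ := by linarith
  have : conj₁ ρ - conj₂ ρ = 1 + 1 / (ρ * (1 + ρ)) := by
    rw [conj₁, conj₂]; field_simp; ring
  rw [this]
  have : 0 < 1 / (ρ * (1 + ρ)) := by positivity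
  linarith

theorem coeff_bound {X : ℝ} (hX : 0 < X) {v : ℝ × ℝ × ℝ}
    (hv : |evalAt ρ v| ≤ ρ * (1 + ρ) * X ∧ |evalAt (conj₁ ρ) v| ≤ X ∧
      |evalAt (conj₂ ρ) v| ≤ 2 * X) :
    |v.1| ≤ 6 * X ∧ |v.2.1| ≤ 6 * X ∧ |v.2.2| ≤ 6 * X := by
  obtain ⟨y0, y1, y2⟩ := hv
  obtain ⟨l1, u1⟩ := conj₁_bounds hρ
  obtain ⟨l2, u2⟩ := conj₂_bounds hρ
  have h12 := one_le_conj₁_sub_conj₂ hρ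
  have hρ0 : 0 < ρ := by linarith
  obtain ⟨f0, f1, f2⟩ := eq_of_evalAt (r := ρ) (s := conj₁ ρ) (t := conj₂ ρ)
    (by linarith) (by linarith) (by linarith) v
  have e1 : ρ * (1 + ρ) ≤ |(ρ - conj₁ ρ) * (ρ - conj₂ ρ)| := by
    rw [abs_of_nonneg (mul_nonneg (by linarith) (by linarith))]
    nlinarith
  have e2 : ρ ≤ |(conj₁ ρ - ρ) * (conj₁ ρ - conj₂ ρ)| := by
    rw [abs_mul, abs_of_neg (by linarith : conj₁ ρ - ρ < 0), abs_of_pos (by linarith)]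
    nlinarith
  have e3 : 1 + ρ ≤ |(conj₂ ρ - ρ) * (conj₂ ρ - conj₁ ρ)| := by
    rw [abs_mul, abs_of_neg (by linarith : conj₂ ρ - ρ < 0),
      abs_of_neg (by linarith : conj₂ ρ - conj₁ ρ < 0)]
    nlinarith
  have p : 0 < ρ * (1 + ρ) := by positivity
  have m1 : |conj₁ ρ * conj₂ ρ| ≤ 2 := by
    rw [abs_of_pos (mul_pos_of_neg_of_neg u1 (by linarith))]; nlinarith
  have m2 : |ρ * conj₂ ρ| ≤ 1 + ρ := by
    have : ρ * conj₂ ρ = -(1 + ρ) := by rw [conj₂]; field_simp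
    rw [this, abs_neg, abs_of_pos (by linarith)]
  have m3 : |ρ * conj₁ ρ| ≤ 1 + ρ := by
    rw [abs_le]; constructor <;> nlinarith
  have n1 : |(-(conj₁ ρ + conj₂ ρ))| ≤ 2 := by rw [abs_le]; constructor <;> linarith
  have n2 : |(-(ρ + conj₂ ρ))| ≤ ρ := by rw [abs_le]; constructor <;> linarith
  have n3 : |(-(ρ + conj₁ ρ))| ≤ 1 + ρ := by rw [abs_le]; constructor <;> linarith
  have o : |(1 : ℝ)| ≤ 1 := by norm_num
  have hX2 : 0 ≤ 2 * X := by linarith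
  have tri : ∀ {a b c : ℝ}, |a| ≤ 2 * X → |b| ≤ 2 * X → |c| ≤ 2 * X → |a + b + c| ≤ 6 * X :=
    fun ha hb hc ↦ (abs_add_three _ _ _).trans (by linarith)
  have hρX : 2 * X ≤ ρ * X := by gcongr
  refine ⟨?_, ?_, ?_⟩
  · rw [f0]
    exact tri (abs_mul_div_le y0 m1 e1 p (by linarith) hX2)
      (abs_mul_div_le y1 m2 e2 hρ0 (by linarith) hX2)
      (abs_mul_div_le y2 m3 e3 (by linarith) le_rfl hX2)
  · rw [f1]
    exact tri (abs_mul_div_le y0 n1 e1 p (by linarith) hX2)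
      (abs_mul_div_le y1 n2 e2 hρ0 (by linarith) hX2)
      (abs_mul_div_le y2 n3 e3 (by linarith) le_rfl hX2)
  · rw [f2]
    refine tri (abs_mul_div_le y0 o e1 p ?_ hX2)
      (abs_mul_div_le y1 o e2 hρ0 (by linarith) hX2)
      (abs_mul_div_le y2 o e3 (by linarith) (by linarith) hX2)
    have := mul_pos p hX
    linarith

theorem eq_zero_of_conjugates {v : ℝ × ℝ × ℝ} (h0 : evalAt ρ v = 0) (h1 : evalAt (conj₁ ρ) v = 0)
    (h2 : evalAt (conj₂ ρ) v = 0) : v = 0 := by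
  obtain ⟨l1, u1⟩ := conj₁_bounds hρ
  obtain ⟨l2, u2⟩ := conj₂_bounds hρ
  obtain ⟨f0, f1, f2⟩ := eq_of_evalAt (r := ρ) (s := conj₁ ρ) (t := conj₂ ρ)
    (by linarith) (by linarith) (by linarith) v
  simp only [h0, h1, h2, zero_mul, zero_div, add_zero] at f0 f1 f2
  exact Prod.ext f0 (Prod.ext f1 f2)

theorem isDilationRegular_fundamentalRegion {X : ℝ} (hX : 0 < X) :
    IsDilationRegular (64 * (6 * (2 * (6 * X) + 1) ^ 2))
      (conjugates ρ ⁻¹' fundamentalRegion ρ (X ^ 3)) := by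
  set c := 6 * (2 * (6 * X) + 1) ^ 2 with hc
  have e : 64 * c = 2 * (2 * (2 * (c + c + (c + c) + (c + c + (c + c))))) := by ring
  rw [e]
  refine .of_split (evalAt ρ) (fun v hv ↦ hv.1.1) fun ε₀ hε₀ ↦
    .of_split (evalAt (conj₁ ρ)) (fun v hv ↦ hv.1.1.2.1) fun ε₁ hε₁ ↦
    .of_split (evalAt (conj₂ ρ)) (fun v hv ↦ hv.1.1.1.2.2) fun ε₂ hε₂ ↦ ?_
  obtain ⟨f, hf⟩ : ∃ f, f = ε₀ • evalAt ρ := ⟨_, rfl⟩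
  obtain ⟨g, hg⟩ : ∃ g, g = ε₁ • evalAt (conj₁ ρ) := ⟨_, rfl⟩
  obtain ⟨h, hh⟩ : ∃ h, h = ε₂ • evalAt (conj₂ ρ) := ⟨_, rfl⟩
  have sign : ∀ {ε : ℝ} (y : ℝ), ε = 1 ∨ ε = -1 → Real.log (ε * y) = Real.log y := by
    rintro ε y (rfl | rfl)
    · rw [one_mul]
    · rw [neg_one_mul, Real.log_neg_eq_log]
  have hfv : ∀ v, f v = ε₀ * evalAt ρ v := fun v ↦ by rw [hf]; rfl
  have hgv : ∀ v, g v = ε₁ * evalAt (conj₁ ρ) v := fun v ↦ by rw [hg]; rfl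
  have hhv : ∀ v, h v = ε₂ * evalAt (conj₂ ρ) v := fun v ↦ by rw [hh]; rfl
  have hlogf : ∀ v, Real.log (f v) = Real.log (evalAt ρ v) := fun v ↦ by rw [hfv, sign _ hε₀]
  have hlogg : ∀ v, Real.log (g v) = Real.log (evalAt (conj₁ ρ) v) := fun v ↦ by
    rw [hgv, sign _ hε₁]
  have hlogh : ∀ v, Real.log (h v) = Real.log (evalAt (conj₂ ρ) v) := fun v ↦ by
    rw [hhv, sign _ hε₂]
  have den := coord_denom_pos hρ
  have hα : 0 ≤ (2 * Real.log ρ - Real.log (1 + ρ)) /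
      (3 * (Real.log ρ * Real.log (1 + ρ) + (Real.log (1 + ρ) - Real.log ρ) ^ 2)) :=
    div_nonneg (by linarith [log_one_add_root_le hρ]) den.le
  have hβ : 0 ≤ (2 * Real.log (1 + ρ) - Real.log ρ) /
      (3 * (Real.log ρ * Real.log (1 + ρ) + (Real.log (1 + ρ) - Real.log ρ) ^ 2)) :=
    div_nonneg (by linarith [log_root_lt hρ, log_root_pos hρ]) den.le
  have reg := isDilationRegular_window (X := 6 * X) (by linarith)
    {v | 0 < f v ∧ 0 < g v ∧ 0 < h v}
    {v | (0 < f v ∧ 0 < g v ∧ 0 < h v) ∧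
      Real.log (X ^ 3) < Real.log (f v) + Real.log (g v) + Real.log (h v)}
    (fun v ↦ coordFst ρ (Real.log (f v)) (Real.log (g v)) (Real.log (h v)))
    (fun v ↦ coordSnd ρ (Real.log (f v)) (Real.log (g v)) (Real.log (h v)))
    (fun τ ↦ by
      convert convex_setOf_le_log_sub_log g f h hα hβ τ using 2
      exact Set.ext fun v ↦ and_congr_left' and_left_comm)
    (fun τ ↦ by
      convert convex_setOf_le_log_sub_log h f g hβ hα τ using 2
      exact Set.ext fun v ↦ and_congr_left' (and_rotate.trans and_rotate))
    (convex_setOf_lt_log_add_log f g h (Real.log (X ^ 3)))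
  convert reg using 1
  ext v
  simp only [Set.mem_inter_iff, Set.mem_ofPred_eq, ← hfv, ← hgv, ← hhv, hlogf, hlogg, hlogh,
    Set.mem_preimage]
  constructor
  · rintro ⟨⟨⟨hv, p0⟩, p1⟩, p2⟩
    have hb := coeff_bound hρ hX (fundamentalRegion_bound hρ hX hv)
    obtain ⟨⟨h0, h1, h2⟩, hs, hr, hN⟩ := hv
    simp only [conjugates] at h0 h1 h2 hs hr hN
    refine ⟨hb, ⟨p0, p1, p2⟩, hs, hr, fun ⟨_, hlt⟩ ↦ ?_⟩
    rw [log_sum_eq h0 h1 h2] at hlt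
    exact hlt.not_ge (Real.log_le_log (abs_pos.mpr (mul_ne_zero (mul_ne_zero h0 h1) h2)) hN)
  · rintro ⟨hb, ⟨p0, p1, p2⟩, hs, hr, hN⟩
    have h0 : evalAt ρ v ≠ 0 := right_ne_zero_of_mul (hfv v ▸ p0.ne')
    have h1 : evalAt (conj₁ ρ) v ≠ 0 := right_ne_zero_of_mul (hgv v ▸ p1.ne')
    have h2 : evalAt (conj₂ ρ) v ≠ 0 := right_ne_zero_of_mul (hhv v ▸ p2.ne')
    refine ⟨⟨⟨⟨⟨h0, h1, h2⟩, hs, hr, ?_⟩, p0⟩, p1⟩, p2⟩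
    by_contra! hlt
    refine hN ⟨⟨p0, p1, p2⟩, ?_⟩
    rw [log_sum_eq h0 h1 h2]
    exact Real.log_lt_log (by positivity) hlt

end

theorem dilate_fundamentalRegion (ρ x : ℝ) {n : ℕ} (hn : 0 < n) :
    dilate n (conjugates ρ ⁻¹' fundamentalRegion ρ x) =
      conjugates ρ ⁻¹' fundamentalRegion ρ (n ^ 3 * x) := by
  have hn' : (0 : ℝ) < n := Nat.cast_pos.mpr hn
  have hev : ∀ t (v : ℝ × ℝ × ℝ), evalAt t (v.1 / n, v.2.1 / n, v.2.2 / n) = evalAt t v / n := by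
    intro t v; simp only [evalAt_apply]; ring
  ext v
  simp only [dilate, Set.mem_ofPred_eq, Set.mem_preimage, conjugates, fundamentalRegion, hev,
    div_ne_zero_iff, and_iff_left hn'.ne']
  refine and_congr_right fun ⟨h0, h1, h2⟩ ↦ ?_
  have hs : ∀ a b c : ℝ, coordFst ρ (a - Real.log n) (b - Real.log n) (c - Real.log n) =
      coordFst ρ a b c := by
    intro a b c; unfold coordFst; ring
  have hr : ∀ a b c : ℝ, coordSnd ρ (a - Real.log n) (b - Real.log n) (c - Real.log n) =
      coordSnd ρ a b c := by
    intro a b c; unfold coordSnd; ring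
  rw [Real.log_div h0 hn'.ne', Real.log_div h1 hn'.ne', Real.log_div h2 hn'.ne', hs, hr]
  have : evalAt ρ v / n * (evalAt (conj₁ ρ) v / n) * (evalAt (conj₂ ρ) v / n) =
      evalAt ρ v * evalAt (conj₁ ρ) v * evalAt (conj₂ ρ) v / n ^ 3 := by
    field_simp
  rw [this, abs_div, abs_of_pos (by positivity : (0 : ℝ) < (n : ℝ) ^ 3), div_le_iff₀ (by positivity),
    mul_comm x]

theorem simplestCubicRoot_spec {a : ℤ} (ha : 7 ≤ a) :
    2 ≤ simplestCubicRoot a ∧ simplestCubicRoot a ^ 3 - (a : ℝ) * simplestCubicRoot a ^ 2 -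
      ((a : ℝ) + 3) * simplestCubicRoot a - 1 = 0 := by
  have ha' : (7 : ℝ) ≤ a := by exact_mod_cast ha
  set S := {x : ℝ | x ^ 3 - (a : ℝ) * x ^ 2 - ((a : ℝ) + 3) * x - 1 = 0} with hS
  have hcont : Continuous fun x : ℝ ↦ x ^ 3 - (a : ℝ) * x ^ 2 - ((a : ℝ) + 3) * x - 1 := by
    fun_prop
  have hclosed : IsClosed S := isClosed_eq hcont continuous_const
  obtain ⟨y, hy, hyS⟩ : ∃ y ∈ Set.Icc (2 : ℝ) (a + 2),
      y ^ 3 - (a : ℝ) * y ^ 2 - ((a : ℝ) + 3) * y - 1 = 0 := by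
    refine intermediate_value_Icc (by linarith) hcont.continuousOn ⟨?_, ?_⟩
    · linarith
    · nlinarith
  have hbdd : BddAbove S := by
    refine ⟨a + 2, fun x hx ↦ ?_⟩
    by_contra! h
    have hx' : x ^ 3 - (a : ℝ) * x ^ 2 - ((a : ℝ) + 3) * x - 1 = 0 := hx
    have h1 : 2 * x ^ 2 ≤ x ^ 3 - a * x ^ 2 := by nlinarith [sq_nonneg x]
    nlinarith
  exact ⟨hy.1.trans (le_csSup hbdd hyS), hclosed.csSup_mem ⟨y, hyS⟩ hbdd⟩

section

variable {a : ℤ} {ρ : ℝ} (hρ : 2 ≤ ρ)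
  (hroot : ρ ^ 3 - (a : ℝ) * ρ ^ 2 - ((a : ℝ) + 3) * ρ - 1 = 0)
include hρ hroot

theorem cast_eq_of_root : (a : ℝ) = (ρ ^ 3 - 3 * ρ - 1) / (ρ * (1 + ρ)) := by
  rw [eq_div_iff (by nlinarith)]
  linear_combination -hroot

theorem eq_conjugate_of_root {z : ℂ} (hz : z ^ 3 - (a : ℂ) * z ^ 2 - ((a : ℂ) + 3) * z - 1 = 0) :
    z = (ρ : ℂ) ∨ z = (conj₁ ρ : ℂ) ∨ z = (conj₂ ρ : ℂ) := by
  have hρ0 : (ρ : ℂ) ≠ 0 := by exact_mod_cast (by linarith : ρ ≠ 0)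
  have hρ1 : (1 : ℂ) + ρ ≠ 0 := by exact_mod_cast (by linarith : 1 + ρ ≠ 0)
  have ha : (a : ℂ) = ((ρ : ℂ) ^ 3 - 3 * ρ - 1) / (ρ * (1 + ρ)) := by
    exact_mod_cast congrArg Complex.ofReal (cast_eq_of_root hρ hroot)
  have : (z - ρ) * ((z - conj₁ ρ) * (z - conj₂ ρ)) = 0 := by
    rw [← hz, ha, conj₁, conj₂]
    push_cast
    field_simp
    ring
  rcases mul_eq_zero.mp this with h | h
  · exact .inl (sub_eq_zero.mp h)
  · rcases mul_eq_zero.mp h with h | h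
    · exact .inr (.inl (sub_eq_zero.mp h))
    · exact .inr (.inr (sub_eq_zero.mp h))

theorem vandermonde_conj :
    ((conj₁ ρ - ρ) * (conj₂ ρ - ρ) * (conj₂ ρ - conj₁ ρ)) ^ 2 = ((a : ℝ) ^ 2 + 3 * a + 9) ^ 2 := by
  have hρ0 : ρ ≠ 0 := by linarith
  have hρ1 : 1 + ρ ≠ 0 := by linarith
  rw [cast_eq_of_root hρ hroot, conj₁, conj₂]
  field_simp
  ring

end

section

variable {a : ℤ} {K : Type*} [Field K] [NumberField K] {θ : K}
  (hθ : θ ^ 3 - (a : K) * θ ^ 2 - ((a : K) + 3) * θ - 1 = 0)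
include hθ

open Polynomial in
theorem finrank_eq_three (ha : 7 ≤ a) (htop : IntermediateField.adjoin ℚ {θ} = ⊤) :
    Module.finrank ℚ K = 3 := by
  set p : ℤ[X] := X ^ 3 - C a * X ^ 2 - C (a + 3) * X - 1 with hp
  have hdeg : p.natDegree = 3 := by rw [hp]; compute_degree!
  have hmonic : p.Monic := by rw [hp]; monicity!
  have hirr : Irreducible p := by
    rw [hmonic.irreducible_iff_roots_eq_zero_of_degree_le_three (by omega) (by omega)]
    refine Multiset.eq_zero_of_forall_notMem fun r hr ↦ ?_
    have hr' : r ^ 3 - a * r ^ 2 - (a + 3) * r - 1 = 0 := by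
      simpa [hp] using (mem_roots'.mp hr).2
    have hu : IsUnit r := isUnit_iff_exists_inv.mpr
      ⟨r ^ 2 - a * r - (a + 3), by linear_combination hr'⟩
    rcases Int.isUnit_iff.mp hu with rfl | rfl
    · omega
    · omega
  have hmin : p.map (algebraMap ℤ ℚ) = minpoly ℚ θ := by
    refine minpoly.eq_of_irreducible_of_monic
      (hmonic.irreducible_iff_irreducible_map_fraction_map.mp hirr) ?_ (hmonic.map _)
    rw [aeval_map_algebraMap]
    have h3 : aeval θ (3 : ℤ[X]) = 3 := map_ofNat _ 3
    simpa [hp, h3] using hθ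
  rw [← IntermediateField.finrank_top', ← htop,
    IntermediateField.adjoin.finrank (Algebra.IsIntegral.isIntegral θ), ← hmin,
    hmonic.natDegree_map, hdeg]

omit [NumberField K] in
theorem exists_coeff_of_mem_adjoin {z : K} (hz : z ∈ Algebra.adjoin ℤ {θ}) :
    ∃ v : ℤ × ℤ × ℤ, z = v.1 + v.2.1 * θ + v.2.2 * θ ^ 2 := by
  induction hz using Algebra.adjoin_induction with
  | mem x hx => exact ⟨(0, 1, 0), by simpa using hx⟩
  | algebraMap r => exact ⟨(r, 0, 0), by simp⟩
  | add x y _ _ hx hy =>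
    obtain ⟨v, rfl⟩ := hx
    obtain ⟨w, rfl⟩ := hy
    exact ⟨v + w, by simp only [Prod.fst_add, Prod.snd_add, Int.cast_add]; ring⟩
  | mul x y _ _ hx hy =>
    obtain ⟨v, rfl⟩ := hx
    obtain ⟨w, rfl⟩ := hy
    refine ⟨(v.1 * w.1 + (v.2.1 * w.2.2 + v.2.2 * w.2.1) + v.2.2 * w.2.2 * a,
      v.1 * w.2.1 + v.2.1 * w.1 + (v.2.1 * w.2.2 + v.2.2 * w.2.1) * (a + 3) +
        v.2.2 * w.2.2 * (a * (a + 3) + 1),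
      v.1 * w.2.2 + v.2.1 * w.2.1 + v.2.2 * w.1 + (v.2.1 * w.2.2 + v.2.2 * w.2.1) * a +
        v.2.2 * w.2.2 * (a ^ 2 + (a + 3))), ?_⟩
    push_cast
    linear_combination ((v.2.1 : K) * w.2.2 + v.2.2 * w.2.1 + v.2.2 * w.2.2 * (θ + a)) * hθ

end

section

variable {a : ℤ} {ρ : ℝ} (hρ : 2 ≤ ρ)
  (hroot : ρ ^ 3 - (a : ℝ) * ρ ^ 2 - ((a : ℝ) + 3) * ρ - 1 = 0)
  {K : Type*} [Field K] [NumberField K] {θ : K}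
  (hθ : θ ^ 3 - (a : K) * θ ^ 2 - ((a : K) + 3) * θ - 1 = 0)
include hρ hroot hθ

theorem exists_embeddings (ha : 7 ≤ a) (htop : IntermediateField.adjoin ℚ {θ} = ⊤) :
    ∃ e : Fin 3 ≃ (K →ₐ[ℚ] ℂ), ∀ j, e j θ = (![ρ, conj₁ ρ, conj₂ ρ] j : ℝ) := by
  classical
  have hval : ∀ φ : K →ₐ[ℚ] ℂ, ∃ j : Fin 3, φ θ = (![ρ, conj₁ ρ, conj₂ ρ] j : ℝ) := by
    intro φ
    have h := congrArg φ hθ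
    simp only [map_sub, map_mul, map_add, map_pow, map_one, map_zero, map_intCast,
      map_ofNat] at h
    rcases eq_conjugate_of_root hρ hroot h with h | h | h
    exacts [⟨0, h⟩, ⟨1, h⟩, ⟨2, h⟩]
  choose i hi using hval
  have hinj : Function.Injective i := by
    intro φ ψ h
    have hfg : φ θ = ψ θ := by rw [hi, hi, h]
    have : (φ : K →ₐ[ℚ] ℂ).comp (IntermediateField.val ⊤) =
        (ψ : K →ₐ[ℚ] ℂ).comp (IntermediateField.val ⊤) := by
      rw [← htop]
      refine IntermediateField.algHom_ext_of_eq_adjoin _ rfl ?_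
      rintro x hx
      rcases hx with rfl
      exact hfg
    ext x
    exact DFunLike.congr_fun this ⟨x, IntermediateField.mem_top⟩
  have hcard : Fintype.card (K →ₐ[ℚ] ℂ) = Fintype.card (Fin 3) := by
    rw [AlgHom.card, finrank_eq_three hθ ha htop, Fintype.card_fin]
  have hbij := (Fintype.bijective_iff_injective_and_card i).mpr ⟨hinj, hcard⟩
  refine ⟨(Equiv.ofBijective i hbij).symm, fun j ↦ ?_⟩
  rw [hi]
  congr 2
  exact (Equiv.ofBijective i hbij).apply_symm_apply j

end

/-- The algebraic integer `v₀ + v₁ θ + v₂ θ²`. -/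
def ofCoeff {R : Type*} [Ring R] (θ : R) (v : ℤ × ℤ × ℤ) : R :=
  v.1 + v.2.1 * θ + v.2.2 * θ ^ 2

/-- The real triple attached to an integral triple. -/
def castTriple (v : ℤ × ℤ × ℤ) : ℝ × ℝ × ℝ := (v.1, v.2.1, v.2.2)

/-- `θ` generates the ring of integers of a cubic field, and the embeddings `e` send `θ` to the
three conjugates of `ρ`. -/
structure IsConjugateSystem {K : Type*} [Field K] [NumberField K] (ρ : ℝ) (θ : 𝓞 K)
    (e : Fin 3 ≃ (K →ₐ[ℚ] ℂ)) : Prop where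
  two_le : 2 ≤ ρ
  finrank_eq : Module.finrank ℚ K = 3
  apply_eq : ∀ j, e j θ = (![ρ, conj₁ ρ, conj₂ ρ] j : ℝ)
  ofCoeff_surjective : Function.Surjective (ofCoeff θ)

namespace IsConjugateSystem

variable {K : Type*} [Field K] [NumberField K] {ρ : ℝ} {θ : 𝓞 K} {e : Fin 3 ≃ (K →ₐ[ℚ] ℂ)}
  (h : IsConjugateSystem ρ θ e)
include h

theorem apply_ofCoeff (j : Fin 3) (v : ℤ × ℤ × ℤ) :
    e j (ofCoeff θ v : 𝓞 K) = (evalAt (![ρ, conj₁ ρ, conj₂ ρ] j) (castTriple v) : ℝ) := by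
  simp [ofCoeff, h.apply_eq, evalAt_apply, castTriple]

theorem ofReal_re (j : Fin 3) (z : K) : ((e j z).re : ℂ) = e j z := by
  obtain ⟨⟨x, d, hd⟩, hx⟩ :=
    IsLocalization.surj (Algebra.algebraMapSubmonoid (𝓞 K) (nonZeroDivisors ℤ)) z
  obtain ⟨n, hn, rfl⟩ := hd
  obtain ⟨v, rfl⟩ := h.ofCoeff_surjective x
  have hn' : (n : ℂ) ≠ 0 := by exact_mod_cast nonZeroDivisors.ne_zero hn
  have hx' : z * n = (ofCoeff θ v : 𝓞 K) := by simpa using hx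
  have := congrArg (e j) hx'
  rw [map_mul, map_intCast, h.apply_ofCoeff, ← eq_div_iff hn'] at this
  rw [this]
  norm_cast

theorem isTotallyReal : IsTotallyReal K := by
  refine ⟨fun w ↦ ?_⟩
  rw [InfinitePlace.isReal_iff, ComplexEmbedding.isReal_iff]
  obtain ⟨j, hj⟩ := e.surjective (w.embedding.toRatAlgHom)
  ext z
  have : w.embedding z = e j z := by rw [hj]; rfl
  rw [ComplexEmbedding.conjugate_coe_eq, this, ← h.ofReal_re, Complex.conj_ofReal]

theorem volume_factor : (2 : ℝ) ^ InfinitePlace.nrRealPlaces K *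
    (2 * Real.pi) ^ InfinitePlace.nrComplexPlaces K * Units.regulator K /
      (Units.torsionOrder K * √|(discr K : ℝ)|) = 4 * Units.regulator K / √|(discr K : ℝ)| := by
  have := h.isTotallyReal
  rw [IsTotallyReal.nrComplexPlaces_eq_zero, ← IsTotallyReal.finrank, h.finrank_eq,
    Units.torsionOrder_eq_two_of_odd_finrank (by rw [h.finrank_eq]; decide), pow_zero, mul_one,
    mul_div_mul_comm]
  push_cast
  ring

theorem ofCoeff_injective : Function.Injective (ofCoeff θ) := by
  intro v w hvw
  have key : ∀ j : Fin 3, evalAt (![ρ, conj₁ ρ, conj₂ ρ] j) (castTriple v - castTriple w) = 0 := by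
    intro j
    rw [map_sub, sub_eq_zero]
    have := h.apply_ofCoeff j v
    rw [hvw, h.apply_ofCoeff] at this
    exact_mod_cast this.symm
  have := sub_eq_zero.mp (eq_zero_of_conjugates h.two_le (key 0) (key 1) (key 2))
  simp only [castTriple, Prod.mk.injEq, Int.cast_inj] at this
  exact Prod.ext this.1 (Prod.ext this.2.1 this.2.2)

/-- The real number to which `e j` sends an algebraic integer. -/
noncomputable def val (_ : IsConjugateSystem ρ θ e) (j : Fin 3) (z : 𝓞 K) : ℝ := (e j z).re

theorem ofReal_val (j : Fin 3) (z : 𝓞 K) : (h.val j z : ℂ) = e j z := h.ofReal_re j z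

theorem val_ofCoeff (j : Fin 3) (v : ℤ × ℤ × ℤ) :
    h.val j (ofCoeff θ v) = evalAt (![ρ, conj₁ ρ, conj₂ ρ] j) (castTriple v) := by
  rw [val, h.apply_ofCoeff, Complex.ofReal_re]

theorem val_mul (j : Fin 3) (y z : 𝓞 K) : h.val j (y * z) = h.val j y * h.val j z := by
  have : (h.val j (y * z) : ℂ) = h.val j y * h.val j z := by
    rw [ofReal_val, ofReal_val, ofReal_val, ← map_mul]
    rfl
  exact_mod_cast this

theorem val_ne_zero (j : Fin 3) {z : 𝓞 K} (hz : z ≠ 0) : h.val j z ≠ 0 := by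
  have : (h.val j z : ℂ) ≠ 0 := by
    rw [ofReal_val, Ne, map_eq_zero]
    exact_mod_cast hz
  exact_mod_cast this

theorem absNorm_span (z : 𝓞 K) :
    (Ideal.absNorm (Ideal.span {z}) : ℝ) = |h.val 0 z * h.val 1 z * h.val 2 z| := by
  have h1 := Algebra.norm_eq_prod_embeddings ℚ ℂ (z : K)
  rw [← Fintype.prod_equiv e (fun j ↦ (h.val j z : ℂ)) _ (fun j ↦ h.ofReal_val j z),
    Fin.prod_univ_three, ← Algebra.coe_norm_int] at h1
  have h2 : ((Algebra.norm ℤ z : ℤ) : ℝ) = h.val 0 z * h.val 1 z * h.val 2 z := by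
    have : ((Algebra.norm ℤ z : ℤ) : ℂ) = h.val 0 z * h.val 1 z * h.val 2 z := by
      rw [← h1]; simp
    exact_mod_cast this
  rw [Ideal.absNorm_span_singleton, ← h2, Nat.cast_natAbs, Int.cast_abs]

theorem discr_eq :
    (discr K : ℝ) = ((conj₁ ρ - ρ) * (conj₂ ρ - ρ) * (conj₂ ρ - conj₁ ρ)) ^ 2 := by
  have hsum : ∀ g : Fin 3 → ℤ, ∑ i, g i • ![1, θ, θ ^ 2] i = ofCoeff θ (g 0, g 1, g 2) := by
    intro g
    simp [Fin.sum_univ_three, ofCoeff]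
  have hli : LinearIndependent ℤ ![1, θ, θ ^ 2] := by
    refine Fintype.linearIndependent_iff.mpr fun g hg ↦ ?_
    rw [hsum] at hg
    have := h.ofCoeff_injective (hg.trans (by simp [ofCoeff] : (0 : 𝓞 K) = ofCoeff θ (0, 0, 0)))
    simp only [Prod.mk.injEq] at this
    intro i
    fin_cases i
    exacts [this.1, this.2.1, this.2.2]
  have hspan : ⊤ ≤ Submodule.span ℤ (Set.range ![1, θ, θ ^ 2]) := by
    rintro z -
    obtain ⟨v, rfl⟩ := h.ofCoeff_surjective z
    have := hsum ![v.1, v.2.1, v.2.2]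
    simp only [Matrix.cons_val] at this
    rw [Submodule.mem_span_range_iff_exists_fun]
    exact ⟨_, this⟩
  set b := Module.Basis.mk hli hspan with hb
  have h1 : ((Algebra.discr ℤ b : ℤ) : ℚ) = Algebra.discr ℚ (fun i ↦ (b i : K)) := by
    rw [Algebra.discr_def, Algebra.discr_def, ← eq_intCast (Int.castRingHom ℚ), RingHom.map_det]
    congr 1
    ext i j
    simp only [RingHom.mapMatrix_apply, Matrix.map_apply, Algebra.traceMatrix_apply,
      Algebra.traceForm_apply, eq_intCast]
    rw [Algebra.coe_trace_int]
    rfl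
  have h2 := Algebra.discr_eq_det_embeddingsMatrixReindex_pow_two ℚ ℂ (fun i ↦ (b i : K)) e
  rw [← h1, NumberField.discr_eq_discr] at h2
  have h3 : (discr K : ℂ) =
      (((conj₁ ρ - ρ) * (conj₂ ρ - ρ) * (conj₂ ρ - conj₁ ρ)) ^ 2 : ℝ) := by
    have e0 : e 0 θ = ρ := h.apply_eq 0
    have e1 : e 1 θ = conj₁ ρ := h.apply_eq 1
    have e2 : e 2 θ = conj₂ ρ := h.apply_eq 2
    have : (discr K : ℂ) = algebraMap ℚ ℂ (discr K : ℚ) := by simp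
    rw [this, h2, Matrix.det_fin_three]
    simp [Algebra.embeddingsMatrixReindex, Algebra.embeddingsMatrix, hb, e0, e1, e2]
    ring
  exact_mod_cast h3

end IsConjugateSystem

/-- The nonzero principal ideals of norm at most `x`. -/
def principalIdeals (K : Type*) [Field K] [NumberField K] (x : ℝ) : Set (Ideal (𝓞 K)) :=
  {I | I ≠ ⊥ ∧ Submodule.IsPrincipal I ∧ (Ideal.absNorm I : ℝ) ≤ x}

theorem card_mk_eq_one (K : Type*) [Field K] [NumberField K] (x : ℝ) :
    Nat.card {I : nonZeroDivisors (Ideal (𝓞 K)) //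
      (Ideal.absNorm (I : Ideal (𝓞 K)) : ℝ) ≤ x ∧ ClassGroup.mk0 I = 1} =
      (principalIdeals K x).ncard := by
  rw [← Nat.card_coe_set_eq]
  refine Nat.card_congr
    ⟨fun I ↦ ⟨I.1.1, nonZeroDivisors.ne_zero I.1.2, (ClassGroup.mk0_eq_one_iff I.1.2).mp I.2.2,
      I.2.1⟩, fun I ↦ ⟨⟨I.1, mem_nonZeroDivisors_of_ne_zero I.2.1⟩, I.2.2.2,
      (ClassGroup.mk0_eq_one_iff _).mpr I.2.2.1⟩, fun _ ↦ rfl, fun _ ↦ rfl⟩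

namespace IsConjugateSystem

variable {K : Type*} [Field K] [NumberField K] {ρ : ℝ} {θ : 𝓞 K} {e : Fin 3 ≃ (K →ₐ[ℚ] ℂ)}
  (h : IsConjugateSystem ρ θ e)

/-- The coordinate of the logarithmic vector of an algebraic integer along the unit `θ`. -/
noncomputable def logFst (z : 𝓞 K) : ℝ :=
  coordFst ρ (Real.log (h.val 0 z)) (Real.log (h.val 1 z)) (Real.log (h.val 2 z))

/-- The coordinate of the logarithmic vector of an algebraic integer along the unit `1 + θ`. -/
noncomputable def logSnd (z : 𝓞 K) : ℝ :=
  coordSnd ρ (Real.log (h.val 0 z)) (Real.log (h.val 1 z)) (Real.log (h.val 2 z))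

/-- The condition that the logarithmic vector lies in the fundamental parallelogram. -/
def Reduced (z : 𝓞 K) : Prop :=
  (0 ≤ h.logFst z ∧ h.logFst z < 1) ∧ (0 ≤ h.logSnd z ∧ h.logSnd z < 1)

/-- The algebraic integers in the fundamental region. -/
def reducedElements (x : ℝ) : Set (𝓞 K) :=
  {z | (h.val 0 z, h.val 1 z, h.val 2 z) ∈ fundamentalRegion ρ x}

theorem mem_reducedElements {x : ℝ} {z : 𝓞 K} : z ∈ h.reducedElements x ↔
    z ≠ 0 ∧ h.Reduced z ∧ (Ideal.absNorm (Ideal.span {z}) : ℝ) ≤ x := by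
  rw [h.absNorm_span]
  constructor
  · rintro ⟨h0, h1, h2, h3⟩
    refine ⟨?_, ⟨h1, h2⟩, h3⟩
    rintro rfl
    exact h0.1 (by simp [val])
  · rintro ⟨h0, ⟨h1, h2⟩, h3⟩
    exact ⟨⟨h.val_ne_zero 0 h0, h.val_ne_zero 1 h0, h.val_ne_zero 2 h0⟩, h1, h2, h3⟩

theorem reducedElements_eq (x : ℝ) : h.reducedElements x =
    ofCoeff θ '' latticePoints (conjugates ρ ⁻¹' fundamentalRegion ρ x) := by
  ext z
  obtain ⟨v, rfl⟩ := h.ofCoeff_surjective z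
  rw [h.ofCoeff_injective.mem_set_image]
  simp only [reducedElements, Set.mem_ofPred_eq, h.val_ofCoeff]
  rfl

theorem ncard_reducedElements (x : ℝ) : (h.reducedElements x).ncard =
    (latticePoints (conjugates ρ ⁻¹' fundamentalRegion ρ x)).ncard := by
  rw [h.reducedElements_eq, Set.ncard_image_of_injective _ h.ofCoeff_injective]

theorem log_val_mul {y z : 𝓞 K} (hy : y ≠ 0) (hz : z ≠ 0) (j : Fin 3) :
    Real.log (h.val j (y * z)) = Real.log (h.val j y) + Real.log (h.val j z) := by
  rw [h.val_mul, Real.log_mul (h.val_ne_zero j hy) (h.val_ne_zero j hz)]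

theorem logFst_mul {y z : 𝓞 K} (hy : y ≠ 0) (hz : z ≠ 0) :
    h.logFst (y * z) = h.logFst y + h.logFst z := by
  simp only [logFst, h.log_val_mul hy hz, coordFst_add]

theorem logSnd_mul {y z : 𝓞 K} (hy : y ≠ 0) (hz : z ≠ 0) :
    h.logSnd (y * z) = h.logSnd y + h.logSnd z := by
  simp only [logSnd, h.log_val_mul hy hz, coordSnd_add]

theorem log_val_zpow (u : (𝓞 K)ˣ) (n : ℤ) (j : Fin 3) :
    Real.log (h.val j (u ^ n : (𝓞 K)ˣ)) = n * Real.log (h.val j u) := by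
  have : (h.val j (u ^ n : (𝓞 K)ˣ) : ℂ) = (h.val j u : ℂ) ^ n := by
    rw [ofReal_val, ofReal_val]
    exact (congrArg (e j) (Units.coe_zpow u n)).trans (map_zpow₀ _ _ _)
  rw [← Complex.ofReal_zpow] at this
  rw [Complex.ofReal_inj.mp this, Real.log_zpow]

theorem logFst_zpow (u : (𝓞 K)ˣ) (n : ℤ) :
    h.logFst (u ^ n : (𝓞 K)ˣ) = n * h.logFst u := by
  simp only [logFst, h.log_val_zpow, coordFst]
  ring

theorem logSnd_zpow (u : (𝓞 K)ˣ) (n : ℤ) :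
    h.logSnd (u ^ n : (𝓞 K)ˣ) = n * h.logSnd u := by
  simp only [logSnd, h.log_val_zpow, coordSnd]
  ring

section Units

variable {u₁ u₂ : (𝓞 K)ˣ} (hu₁ : (u₁ : 𝓞 K) = θ) (hu₂ : (u₂ : 𝓞 K) = 1 + θ)
include h hu₁ hu₂

theorem log_units : h.logFst u₁ = 1 ∧ h.logSnd u₁ = 0 ∧ h.logFst u₂ = 0 ∧ h.logSnd u₂ = 1 := by
  have e1 : ∀ j, h.val j u₁ = ![ρ, conj₁ ρ, conj₂ ρ] j := fun j ↦ by
    rw [hu₁, val, h.apply_eq, Complex.ofReal_re]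
  have e2 : ∀ j, h.val j u₂ = 1 + ![ρ, conj₁ ρ, conj₂ ρ] j := fun j ↦ by
    rw [hu₂, val, show ((1 + θ : 𝓞 K) : K) = 1 + θ from rfl, map_add, map_one, h.apply_eq,
      Complex.add_re, Complex.ofReal_re, Complex.one_re]
  simp only [logFst, logSnd, e1, e2, Matrix.cons_val]
  exact ⟨coordFst_root h.two_le, coordSnd_root h.two_le, coordFst_one_add_root h.two_le,
    coordSnd_one_add_root h.two_le⟩

theorem log_mul_units {z : 𝓞 K} (hz : z ≠ 0) (m n : ℤ) :
    h.logFst (z * (u₁ ^ m * u₂ ^ n : (𝓞 K)ˣ)) = h.logFst z + m ∧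
      h.logSnd (z * (u₁ ^ m * u₂ ^ n : (𝓞 K)ˣ)) = h.logSnd z + n := by
  obtain ⟨h1, h2, h3, h4⟩ := h.log_units hu₁ hu₂
  rw [h.logFst_mul hz (_root_.Units.ne_zero _), h.logSnd_mul hz (_root_.Units.ne_zero _),
    _root_.Units.val_mul, h.logFst_mul (_root_.Units.ne_zero _) (_root_.Units.ne_zero _),
    h.logSnd_mul (_root_.Units.ne_zero _) (_root_.Units.ne_zero _), h.logFst_zpow, h.logFst_zpow,
    h.logSnd_zpow, h.logSnd_zpow, h1, h2, h3, h4]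
  constructor <;> ring

theorem reduced_mul_floor {z : 𝓞 K} (hz : z ≠ 0) :
    h.Reduced (z * (u₁ ^ (-⌊h.logFst z⌋) * u₂ ^ (-⌊h.logSnd z⌋) : (𝓞 K)ˣ)) := by
  obtain ⟨h1, h2⟩ := h.log_mul_units hu₁ hu₂ hz (-⌊h.logFst z⌋) (-⌊h.logSnd z⌋)
  rw [Reduced, h1, h2]
  push_cast
  simp only [← sub_eq_add_neg]
  exact ⟨⟨Int.fract_nonneg _, Int.fract_lt_one _⟩, ⟨Int.fract_nonneg _, Int.fract_lt_one _⟩⟩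

theorem eq_zero_of_reduced {z : 𝓞 K} (hz : z ≠ 0) (hr : h.Reduced z) {m n : ℤ}
    (hr' : h.Reduced (z * (u₁ ^ m * u₂ ^ n : (𝓞 K)ˣ))) : m = 0 ∧ n = 0 := by
  obtain ⟨h1, h2⟩ := h.log_mul_units hu₁ hu₂ hz m n
  rw [Reduced, h1, h2] at hr'
  obtain ⟨⟨a1, a2⟩, ⟨a3, a4⟩⟩ := hr
  obtain ⟨⟨b1, b2⟩, ⟨b3, b4⟩⟩ := hr'
  have m1 : (m : ℝ) < 1 := by linarith
  have m2 : (-1 : ℝ) < m := by linarith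
  have n1 : (n : ℝ) < 1 := by linarith
  have n2 : (-1 : ℝ) < n := by linarith
  norm_cast at m1 n1
  have m2' : -1 < m := by exact_mod_cast m2
  have n2' : -1 < n := by exact_mod_cast n2
  omega

theorem ncard_mul_ncard (x : ℝ) :
    (principalIdeals K x).ncard * {u : (𝓞 K)ˣ | h.Reduced u}.ncard =
      (h.reducedElements x).ncard := by
  classical
  rw [← Nat.card_coe_set_eq, ← Nat.card_coe_set_eq, ← Nat.card_coe_set_eq, ← Nat.card_prod]
  have hgen : ∀ I : principalIdeals K x, ∃ g : 𝓞 K, I.1 = Ideal.span {g} ∧ g ≠ 0 := by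
    rintro ⟨I, hI, ⟨g, hg⟩, hx⟩
    refine ⟨g, hg, ?_⟩
    rintro rfl
    exact hI (by rw [hg]; simp)
  choose gen hgen hgen0 using hgen
  have hne : ∀ (I : principalIdeals K x) (u : (𝓞 K)ˣ), gen I * u ≠ 0 := fun I u ↦
    mul_ne_zero (hgen0 I) u.ne_zero
  set τ : 𝓞 K → (𝓞 K)ˣ := fun z ↦ u₁ ^ (-⌊h.logFst z⌋) * u₂ ^ (-⌊h.logSnd z⌋) with hτ
  have hspan : ∀ (I : principalIdeals K x) (u : (𝓞 K)ˣ),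
      Ideal.span {gen I * u * τ (gen I * u)} = I.1 := by
    intro I u
    rw [hgen I, mul_assoc, ← _root_.Units.val_mul,
      Ideal.span_singleton_mul_right_unit (_root_.Units.isUnit _)]
  let F : principalIdeals K x × {u : (𝓞 K)ˣ | h.Reduced u} → h.reducedElements x := fun p ↦
    ⟨gen p.1 * p.2.1 * τ (gen p.1 * p.2.1), h.mem_reducedElements.mpr
      ⟨mul_ne_zero (hne _ _) (_root_.Units.ne_zero _), h.reduced_mul_floor hu₁ hu₂ (hne _ _), by
        rw [hspan]; exact p.1.2.2.2⟩⟩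
  refine Nat.card_congr (Equiv.ofBijective F ⟨?_, ?_⟩)
  · rintro ⟨I, u, hu⟩ ⟨J, w, hw⟩ hF
    have hF' : gen I * u * τ (gen I * u) = gen J * w * τ (gen J * w) := congrArg Subtype.val hF
    obtain rfl : I = J := Subtype.ext (by rw [← hspan I u, hF', hspan])
    obtain ⟨m, n, hmn⟩ : ∃ m n : ℤ, (τ (gen I * u)) * (τ (gen I * w))⁻¹ = u₁ ^ m * u₂ ^ n :=
      ⟨-⌊h.logFst (gen I * u)⌋ + ⌊h.logFst (gen I * w)⌋,
        -⌊h.logSnd (gen I * u)⌋ + ⌊h.logSnd (gen I * w)⌋, by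
        simp only [hτ, zpow_add, zpow_neg, mul_inv, inv_inv]
        exact mul_mul_mul_comm _ _ _ _⟩
    have huw : u * (u₁ ^ m * u₂ ^ n) = w := by
      rw [← hmn, ← mul_assoc, mul_inv_eq_iff_eq_mul]
      refine _root_.Units.ext (mul_left_cancel₀ (hgen0 I) ?_)
      rw [_root_.Units.val_mul u (τ _), _root_.Units.val_mul w (τ _), ← mul_assoc, ← mul_assoc,
        hF']
    obtain ⟨rfl, rfl⟩ := h.eq_zero_of_reduced hu₁ hu₂ u.ne_zero hu (m := m) (n := n) (by
      rw [← _root_.Units.val_mul, huw]; exact hw)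
    simp only [zpow_zero, mul_one] at huw
    subst huw
    rfl
  · rintro ⟨z, hz⟩
    obtain ⟨hz0, hzr, hzx⟩ := h.mem_reducedElements.mp hz
    set I : principalIdeals K x := ⟨Ideal.span {z}, by simpa using hz0, ⟨z, rfl⟩, hzx⟩ with hI
    obtain ⟨w, hw⟩ : Associated (gen I) z :=
      Ideal.span_singleton_eq_span_singleton.mp (hgen I).symm
    refine ⟨⟨I, w * τ w, ?_⟩, Subtype.ext ?_⟩
    · have := h.reduced_mul_floor hu₁ hu₂ w.ne_zero
      rwa [← _root_.Units.val_mul] at this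
    · change gen I * (w * τ w : (𝓞 K)ˣ) * τ (gen I * (w * τ w : (𝓞 K)ˣ)) = z
      obtain ⟨m, n, hmn⟩ : ∃ m n : ℤ,
          τ w * τ (gen I * (w * τ w : (𝓞 K)ˣ)) = u₁ ^ m * u₂ ^ n :=
        ⟨-⌊h.logFst w⌋ + -⌊h.logFst (gen I * (w * τ w : (𝓞 K)ˣ))⌋,
          -⌊h.logSnd w⌋ + -⌊h.logSnd (gen I * (w * τ w : (𝓞 K)ˣ))⌋, by
          simp only [hτ, zpow_add]
          exact mul_mul_mul_comm _ _ _ _⟩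
      have key : gen I * (w * τ w : (𝓞 K)ˣ) * τ (gen I * (w * τ w : (𝓞 K)ˣ)) =
          z * (u₁ ^ m * u₂ ^ n : (𝓞 K)ˣ) := by
        rw [← hmn, ← hw]
        push_cast
        ring
      have hr := h.reduced_mul_floor hu₁ hu₂ (hne I (w * τ w))
      rw [key] at hr
      obtain ⟨rfl, rfl⟩ := h.eq_zero_of_reduced hu₁ hu₂ hz0 hzr hr
      rw [key]
      simp

theorem abs_ncard_principalIdeals_sub_le {X : ℝ} (hX : 0 < X) {n : ℕ} (hn : 0 < n) :
    |((principalIdeals K (n ^ 3 * X ^ 3)).ncard : ℝ) -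
      n ^ 3 * (principalIdeals K (X ^ 3)).ncard| ≤ n ^ 3 * (64 * (6 * (2 * (6 * X) + 1) ^ 2)) := by
  have hfin : {u : (𝓞 K)ˣ | h.Reduced u}.Finite := by
    have hE : (h.reducedElements 1).Finite := by
      have := (isDilationRegular_fundamentalRegion h.two_le one_pos).1
      rw [one_pow] at this
      rw [h.reducedElements_eq]
      exact this.image _
    refine (hE.preimage (f := fun u : (𝓞 K)ˣ ↦ (u : 𝓞 K)) Units.val_injective.injOn).subset ?_
    intro u hu
    refine h.mem_reducedElements.mpr ⟨u.ne_zero, hu, ?_⟩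
    rw [Ideal.span_singleton_eq_top.mpr u.isUnit]
    simp
  have hone : (1 : (𝓞 K)ˣ) ∈ {u : (𝓞 K)ˣ | h.Reduced u} := by
    have h1 := h.logFst_zpow 1 0
    have h2 := h.logSnd_zpow 1 0
    rw [zpow_zero, Int.cast_zero, zero_mul] at h1 h2
    simp only [Set.mem_ofPred_eq, Reduced, h1, h2, le_refl, zero_lt_one, and_self]
  have hM : (1 : ℝ) ≤ {u : (𝓞 K)ˣ | h.Reduced u}.ncard := by
    exact_mod_cast (Set.ncard_pos hfin).mpr ⟨1, hone⟩
  have hreg := ((isDilationRegular_fundamentalRegion h.two_le hX).2 n hn).2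
  rw [dilate_fundamentalRegion ρ _ hn, ← h.ncard_reducedElements, ← h.ncard_reducedElements,
    ← h.ncard_mul_ncard hu₁ hu₂, ← h.ncard_mul_ncard hu₁ hu₂, Nat.cast_mul, Nat.cast_mul,
    ← mul_assoc, ← sub_mul, abs_mul, Nat.abs_cast] at hreg
  exact (le_mul_of_one_le_right (abs_nonneg _) hM).trans hreg

theorem abs_ncard_principalIdeals_sub_volume_le {X : ℝ} (hX : 0 < X) :
    |((principalIdeals K (X ^ 3)).ncard : ℝ) -
      4 * NumberField.Units.regulator K / √|(discr K : ℝ)| * X ^ 3| ≤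
        64 * (6 * (2 * (6 * X) + 1) ^ 2) := by
  have hlim := Ideal.tendsto_norm_le_and_mk_eq_div_atTop K 1
  simp only [card_mk_eq_one, h.volume_factor] at hlim
  have hX3 : 0 < X ^ 3 := by positivity
  have hseq : Filter.Tendsto (fun n : ℕ ↦ (n : ℝ) ^ 3 * X ^ 3) Filter.atTop Filter.atTop :=
    ((Filter.tendsto_pow_atTop three_ne_zero).comp tendsto_natCast_atTop_atTop).atTop_mul_const hX3
  have hlim' := (((hlim.comp hseq).mul_const (X ^ 3)).const_sub
    ((principalIdeals K (X ^ 3)).ncard : ℝ)).abs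
  refine le_of_tendsto hlim' ?_
  filter_upwards [Filter.eventually_gt_atTop 0] with n hn
  have hn3 : (0 : ℝ) < (n : ℝ) ^ 3 := by positivity
  have := h.abs_ncard_principalIdeals_sub_le hu₁ hu₂ hX hn
  rw [← mul_le_mul_iff_right₀ hn3]
  refine le_trans (le_of_eq ?_) this
  rw [← abs_of_pos hn3, ← abs_mul, abs_of_pos hn3, abs_sub_comm]
  congr 1
  simp only [Function.comp_apply]
  field_simp

end Units

end IsConjugateSystem

theorem error_bound {a : ℤ} (ha : 7 ≤ a) {x X : ℝ} (hx : 1 ≤ x) (hX : X = x ^ ((1 : ℝ) / 3)) :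
    64 * (6 * (2 * (6 * X) + 1) ^ 2) ≤
      ((3 : ℝ) ^ (900 : ℕ) * ((3 : ℝ) / 2) ^ ((5 : ℝ) / 3)) * (Real.log a) ^ ((10 : ℝ) / 3)
        * x ^ ((2 : ℝ) / 3) := by
  have hX1 : 1 ≤ X := hX ▸ Real.one_le_rpow hx (by norm_num)
  have hX2 : x ^ ((2 : ℝ) / 3) = X ^ 2 := by
    rw [hX, ← Real.rpow_mul_natCast (by linarith)]
    norm_num
  have hlog : 1 ≤ Real.log a := by
    rw [Real.le_log_iff_exp_le (by exact_mod_cast (by omega : 0 < a))]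
    have : (7 : ℝ) ≤ a := by exact_mod_cast ha
    linarith [Real.exp_one_lt_d9]
  have h1 : (1 : ℝ) ≤ ((3 : ℝ) / 2) ^ ((5 : ℝ) / 3) := Real.one_le_rpow (by norm_num) (by norm_num)
  have h2 : (1 : ℝ) ≤ (Real.log a) ^ ((10 : ℝ) / 3) := Real.one_le_rpow hlog (by norm_num)
  have h3 : (64 * 6 * 169 : ℝ) ≤ (3 : ℝ) ^ (900 : ℕ) :=
    le_trans (by norm_num) (pow_le_pow_right₀ (by norm_num) (by norm_num : 11 ≤ 900))
  rw [hX2]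
  calc 64 * (6 * (2 * (6 * X) + 1) ^ 2) ≤ 64 * (6 * (13 * X) ^ 2) := by gcongr; linarith
    _ = 64 * 6 * 169 * 1 * 1 * X ^ 2 := by ring
    _ ≤ _ := by gcongr

theorem stmt_2 :
    ∀ (a : ℤ), 7 ≤ a →
    ∀ (K : Type) [Field K] [NumberField K] (σ : K →+* ℝ) (ρK : K),
      σ ρK = simplestCubicRoot a →
      IntermediateField.adjoin ℚ {ρK} = ⊤ →
      Algebra.adjoin ℤ {ρK} = integralClosure ℤ K →
      ∀ x : ℝ, 1 ≤ x →
        |(Set.ncard {I : Ideal (RingOfIntegers K) |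
              I ≠ ⊥ ∧ Submodule.IsPrincipal I ∧ (Ideal.absNorm I : ℝ) ≤ x} : ℝ)
            - (4 * NumberField.Units.regulator K / ((a : ℝ) ^ 2 + 3 * a + 9)) * x| ≤
          ((3 : ℝ) ^ (900 : ℕ) * ((3 : ℝ) / 2) ^ ((5 : ℝ) / 3)) * (Real.log a) ^ ((10 : ℝ) / 3)
            * x ^ ((2 : ℝ) / 3) := by
  intro a ha K _ _ σ ρK hσ htop hadj x hx
  obtain ⟨hρ, hroot⟩ := simplestCubicRoot_spec ha
  set ρ := simplestCubicRoot a
  have hK : ρK ^ 3 - (a : K) * ρK ^ 2 - ((a : K) + 3) * ρK - 1 = 0 := by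
    refine σ.injective ?_
    simpa only [map_sub, map_mul, map_add, map_pow, map_one, map_zero, map_intCast, map_ofNat, hσ]
      using hroot
  have hmem : ρK ∈ integralClosure ℤ K := hadj ▸ Algebra.self_mem_adjoin_singleton ℤ ρK
  obtain ⟨e, he⟩ := exists_embeddings hρ hroot hK ha htop
  obtain ⟨θ, rfl⟩ : ∃ θ : 𝓞 K, (θ : K) = ρK := ⟨⟨ρK, hmem⟩, rfl⟩
  have hθ : θ ^ 3 - (a : 𝓞 K) * θ ^ 2 - ((a : 𝓞 K) + 3) * θ - 1 = 0 := by
    refine RingOfIntegers.ext ?_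
    have h3 : algebraMap (𝓞 K) K 3 = 3 := map_ofNat _ 3
    simpa [h3] using hK
  have h : IsConjugateSystem ρ θ e :=
    { two_le := hρ
      finrank_eq := finrank_eq_three hK ha htop
      apply_eq := he
      ofCoeff_surjective := by
        intro z
        obtain ⟨v, hv⟩ := exists_coeff_of_mem_adjoin hK (z := (z : K)) (hadj ▸ z.2)
        refine ⟨v, RingOfIntegers.ext ?_⟩
        rw [hv]
        simp [ofCoeff] }
  let u₁ : (𝓞 K)ˣ := Units.mkOfMulEqOne θ (θ ^ 2 - a * θ - (a + 3)) (by linear_combination hθ)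
  let u₂ : (𝓞 K)ˣ := Units.mkOfMulEqOne (1 + θ) (-θ ^ 2 + (a + 1) * θ + 2)
    (by linear_combination -hθ)
  have hdiscr : √|(discr K : ℝ)| = (a : ℝ) ^ 2 + 3 * a + 9 := by
    have ha' : (7 : ℝ) ≤ a := by exact_mod_cast ha
    rw [h.discr_eq, vandermonde_conj hρ hroot, abs_of_nonneg (sq_nonneg _),
      Real.sqrt_sq (by positivity)]
  obtain ⟨X, hX⟩ : ∃ X : ℝ, X = x ^ ((1 : ℝ) / 3) := ⟨_, rfl⟩
  have hX0 : 0 < X := hX ▸ Real.rpow_pos_of_pos (by linarith) _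
  have hX3 : X ^ 3 = x := by
    rw [hX, ← Real.rpow_mul_natCast (by linarith)]
    norm_num
  have key := h.abs_ncard_principalIdeals_sub_volume_le (u₁ := u₁) (u₂ := u₂) rfl rfl hX0
  rw [hdiscr, hX3] at key
  exact key.trans (error_bound ha hx hX)
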